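/- Let {x^k} be generated by Algorithm 1. Suppose Assumption 2 holds and that F is a KL function of exponent θ ∈ [(q−1)/q, 1). Then {x^k} converges to a point x̄ ∈ 𝒮*, and there exist α > 0 and ρ ∈ (0,1) such that for all sufficiently large k: ‖x^k − x̄‖ ≤ α ρ^k if θ = (q−1)/q, and ‖x^k − x̄‖ ≤ α k^{(1−θ)/(1−(qθ)/(q−1))} if θ ∈ ((q−1)/q, 1). -/

import Mathlib

open Filter Metric Real Set
open scoped InnerProductSpace Topology Pointwise

/-- The convex subdifferential of an extended-real-valued function `g` at `x`. -/
noncomputable def ESubdiff {X : Type*} [NormedAddCommGroup X] [InnerProductSpace ℝ X]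
    (g : X → EReal) (x : X) : Set X :=
  {v | ∀ z : X, g x + ((⟪v, z - x⟫_ℝ : ℝ) : EReal) ≤ g z}

theorem rpow_sub_rpow_le_of_one_le {q s t : ℝ} (hq : 1 ≤ q) (hs : 0 < s) (ht : 0 ≤ t) :
    s ^ (q - 1) * (q * t - (q - 1) * s) ≤ t ^ q := by
  have h := one_add_mul_self_le_rpow_one_add (s := t / s - 1)
    (by have := div_nonneg ht hs.le; linarith) hq
  have h1 : (1 + (t / s - 1)) ^ q = t ^ q / s ^ q := by
    rw [← div_rpow ht hs.le]; ring_nf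
  have hsq : s ^ q = s ^ (q - 1) * s := by
    rw [← rpow_add_one hs.ne']; ring_nf
  have hpos : 0 < s ^ q := rpow_pos_of_pos hs q
  rw [h1, le_div_iff₀ hpos, hsq] at h
  calc s ^ (q - 1) * (q * t - (q - 1) * s)
      = (1 + q * (t / s - 1)) * (s ^ (q - 1) * s) := by field_simp; ring
    _ ≤ t ^ q := h

theorem one_sub_mul_sub_le_rpow_mul {θ a b : ℝ} (hθ0 : 0 ≤ θ) (hθ1 : θ ≤ 1) (ha : 0 < a)
    (hb : 0 < b) :
    (1 - θ) * (a - b) ≤ a ^ θ * (a ^ (1 - θ) - b ^ (1 - θ)) := by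
  have h := rpow_one_add_le_one_add_mul_self (s := b / a - 1) (p := 1 - θ)
    (by have := div_pos hb ha; linarith) (by linarith) (by linarith)
  have h1 : (1 + (b / a - 1)) ^ (1 - θ) = b ^ (1 - θ) / a ^ (1 - θ) := by
    rw [← div_rpow hb.le ha.le]; ring_nf
  have hpos : 0 < a ^ (1 - θ) := rpow_pos_of_pos ha _
  rw [h1, div_le_iff₀ hpos] at h
  have haa : a ^ θ * a ^ (1 - θ) = a := by
    rw [← rpow_add ha]; simp
  have h2 := mul_le_mul_of_nonneg_left h (rpow_pos_of_pos ha θ).le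
  have h3 : a ^ θ * ((1 + (1 - θ) * (b / a - 1)) * a ^ (1 - θ)) = a + (1 - θ) * (b - a) := by
    calc _ = (1 + (1 - θ) * (b / a - 1)) * (a ^ θ * a ^ (1 - θ)) := by ring
      _ = _ := by rw [haa]; field_simp
  rw [h3] at h2
  have h4 : a ^ θ * (a ^ (1 - θ) - b ^ (1 - θ)) = a - a ^ θ * b ^ (1 - θ) := by
    rw [mul_sub, haa]
  rw [h4]
  linarith

theorem kl_step_length_le {q θ a C s s' Δ Δ' : ℝ} (hq : 1 < q) (hθ0 : 0 ≤ θ) (hθ1 : θ < 1)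
    (ha : 0 < a) (hs : 0 < s) (hs' : 0 ≤ s') (hΔ : 0 < Δ) (hΔ' : 0 < Δ')
    (hdec : a * s' ^ q ≤ Δ - Δ') (hkl : Δ ^ θ ≤ C * s ^ (q - 1)) :
    q * s' ≤ (q - 1) * s + C / (a * (1 - θ)) * (Δ ^ (1 - θ) - Δ' ^ (1 - θ)) := by
  have h1 := one_sub_mul_sub_le_rpow_mul hθ0 hθ1.le hΔ hΔ'
  have h2 := rpow_sub_rpow_le_of_one_le hq.le hs hs'
  have hle : Δ' ≤ Δ := by
    have : 0 ≤ a * s' ^ q := by positivity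
    linarith
  have hD : 0 ≤ Δ ^ (1 - θ) - Δ' ^ (1 - θ) :=
    sub_nonneg.2 (rpow_le_rpow hΔ'.le hle (by linarith))
  have hsq : 0 < s ^ (q - 1) := rpow_pos_of_pos hs _
  have h1θ : 0 < 1 - θ := by linarith
  have h3 : (1 - θ) * (a * (s ^ (q - 1) * (q * s' - (q - 1) * s)))
      ≤ C * s ^ (q - 1) * (Δ ^ (1 - θ) - Δ' ^ (1 - θ)) :=
    calc _ ≤ (1 - θ) * (a * s' ^ q) := by gcongr
      _ ≤ (1 - θ) * (Δ - Δ') := by gcongr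
      _ ≤ _ := h1
      _ ≤ _ := by gcongr
  have h4 : (q * s' - (q - 1) * s) * (a * (1 - θ)) ≤ C * (Δ ^ (1 - θ) - Δ' ^ (1 - θ)) := by
    refine le_of_mul_le_mul_left ?_ hsq
    linarith
  have h5 := (le_div_iff₀ (mul_pos ha h1θ)).2 h4
  have h6 : C / (a * (1 - θ)) * (Δ ^ (1 - θ) - Δ' ^ (1 - θ))
      = C * (Δ ^ (1 - θ) - Δ' ^ (1 - θ)) / (a * (1 - θ)) := by ring
  rw [h6]
  linarith

theorem rpow_neg_sub_rpow_neg_add_one_le {β t : ℝ} (hβ : 0 < β) (ht : 0 < t) :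
    t ^ (-β) - (t + 1) ^ (-β) ≤ β * t ^ (-β - 1) := by
  have h1 : (t + 1) ^ (-β) = t ^ (-β) * (1 + 1 / t) ^ (-β) := by
    rw [← mul_rpow ht.le (by positivity)]
    congr 1; field_simp
  have h2 : 1 - β / t ≤ (1 + 1 / t) ^ (-β) := by
    have hpos : 0 < 1 + 1 / t := by positivity
    rw [rpow_def_of_pos hpos]
    have h3 : Real.log (1 + 1 / t) ≤ 1 / t := by
      have := log_le_sub_one_of_pos hpos; linarith
    have h4 := add_one_le_exp (Real.log (1 + 1 / t) * -β)
    have h5 : Real.log (1 + 1 / t) * β ≤ 1 / t * β := by gcongr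
    have h6 : 1 / t * β = β / t := by ring
    linarith
  have h3 := mul_le_mul_of_nonneg_left h2 (rpow_pos_of_pos ht (-β)).le
  have h4 : t ^ (-β - 1) = t ^ (-β) / t := by rw [rpow_sub ht, rpow_one]
  rw [h1, h4]
  have h5 : β * (t ^ (-β) / t) = t ^ (-β) * (β / t) := by ring
  rw [h5]
  linarith

theorem exists_le_mul_rpow_neg_of_recursion {Δ : ℕ → ℝ} {p C : ℝ} (hp : 1 < p) (hC : 0 < C)
    {K : ℕ} (hK : 1 ≤ K)
    (hrec : ∀ k, K ≤ k → Δ (k + 1) ^ p ≤ C * (Δ k - Δ (k + 1))) :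
    ∃ A : ℝ, 0 < A ∧ ∀ k, K ≤ k → Δ k ≤ A * (k : ℝ) ^ (-(1 / (p - 1))) := by
  set β := 1 / (p - 1) with hβdef
  have hp1 : 0 < p - 1 := by linarith
  have hβ : 0 < β := by positivity
  have hβp : β * p = β + 1 := by rw [hβdef]; field_simp; ring
  set A₁ := (C * β * 2 ^ (β + 1)) ^ β with hA₁
  have hA₁pos : 0 < A₁ := by positivity
  have hA₁p : A₁ ^ (p - 1) = C * β * 2 ^ (β + 1) := by
    rw [hA₁, ← rpow_mul (by positivity), hβdef]
    rw [one_div, inv_mul_cancel₀ hp1.ne', rpow_one]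
  have hK0 : (0 : ℝ) < K := by exact_mod_cast hK
  set A := max A₁ (Δ K * (K : ℝ) ^ β) with hA
  have hApos : 0 < A := lt_max_of_lt_left hA₁pos
  refine ⟨A, hApos, fun k hk => ?_⟩
  induction k, hk using Nat.le_induction with
  | base =>
    have : Δ K = Δ K * (K : ℝ) ^ β * (K : ℝ) ^ (-β) := by
      rw [mul_assoc, ← rpow_add hK0]; simp
    rw [this]
    gcongr
    exact le_max_right _ _
  | succ k hk ih =>
    by_contra! hcon
    have hk0 : (1 : ℝ) ≤ k := by exact_mod_cast hK.trans hk
    push_cast at hcon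
    have h1 : (A * ((k : ℝ) + 1) ^ (-β)) ^ p ≤ Δ (k + 1) ^ p := by
      gcongr
    have h2 : (A * ((k : ℝ) + 1) ^ (-β)) ^ p = A ^ p * ((k : ℝ) + 1) ^ (-β - 1) := by
      rw [mul_rpow hApos.le (by positivity), ← rpow_mul (by positivity)]
      congr 2; linarith
    have h3 := hrec k hk
    have h4 : C * (Δ k - Δ (k + 1)) < C * (A * ((k : ℝ) ^ (-β) - ((k : ℝ) + 1) ^ (-β))) := by
      gcongr
      linarith
    have h5 : C * (A * ((k : ℝ) ^ (-β) - ((k : ℝ) + 1) ^ (-β)))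
        ≤ C * (A * (β * (k : ℝ) ^ (-β - 1))) := by
      gcongr
      exact rpow_neg_sub_rpow_neg_add_one_le hβ (by linarith)
    have h6 : (k : ℝ) ^ (-β - 1) ≤ 2 ^ (β + 1) * ((k : ℝ) + 1) ^ (-β - 1) := by
      have h7 : ((k : ℝ) * 2) ^ (-β - 1) ≤ ((k : ℝ) + 1) ^ (-β - 1) :=
        rpow_le_rpow_of_nonpos (by positivity) (by linarith) (by linarith)
      rw [mul_rpow (by positivity) (by positivity)] at h7
      have h8 : (2 : ℝ) ^ (β + 1) * 2 ^ (-β - 1) = 1 := by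
        rw [← rpow_add (by norm_num)]; ring_nf; simp
      calc (k : ℝ) ^ (-β - 1) = 2 ^ (β + 1) * ((k : ℝ) ^ (-β - 1) * 2 ^ (-β - 1)) := by
            linear_combination (-(k : ℝ) ^ (-β - 1)) * h8
        _ ≤ _ := by gcongr
    have hkp : 0 < ((k : ℝ) + 1) ^ (-β - 1) := by positivity
    have h9 : A ^ p * ((k : ℝ) + 1) ^ (-β - 1)
        < (C * β * 2 ^ (β + 1)) * A * ((k : ℝ) + 1) ^ (-β - 1) := by
      calc _ ≤ Δ (k + 1) ^ p := h2 ▸ h1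
        _ < _ := h3.trans_lt (h4.trans_le h5)
        _ ≤ C * (A * (β * (2 ^ (β + 1) * ((k : ℝ) + 1) ^ (-β - 1)))) := by gcongr
        _ = _ := by ring
    have h10 := lt_of_mul_lt_mul_right h9 hkp.le
    have h11 : A ^ p = A ^ (p - 1) * A := by
      rw [← rpow_add_one hApos.ne']; ring_nf
    rw [h11] at h10
    have h12 := lt_of_mul_lt_mul_right h10 hApos.le
    have h13 : A₁ ^ (p - 1) ≤ A ^ (p - 1) := by
      gcongr
      exact le_max_left _ _
    linarith

theorem exists_le_mul_pow_of_recursion {Δ : ℕ → ℝ} {C : ℝ} (hC : 0 < C) {K : ℕ}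
    (hpos : ∀ k, K ≤ k → 0 < Δ k)
    (hrec : ∀ k, K ≤ k → Δ (k + 1) ≤ C * (Δ k - Δ (k + 1))) :
    ∃ A : ℝ, 0 < A ∧ ∃ r ∈ Ioo (0 : ℝ) 1, ∀ k, K ≤ k → Δ k ≤ A * r ^ k := by
  set r := C / (1 + C) with hr
  have hr0 : 0 < r := by positivity
  have hr1 : r < 1 := by rw [hr, div_lt_one (by positivity)]; linarith
  refine ⟨Δ K / r ^ K, div_pos (hpos K le_rfl) (by positivity), r, ⟨hr0, hr1⟩, fun k hk => ?_⟩
  induction k, hk using Nat.le_induction with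
  | base => field_simp; exact le_rfl
  | succ k hk ih =>
    have h1 : Δ (k + 1) ≤ r * Δ k := by
      have h2 := hrec k hk
      have h3 : r * Δ k = C * Δ k / (1 + C) := by rw [hr]; ring
      rw [h3, le_div_iff₀ (by positivity)]
      linarith
    calc Δ (k + 1) ≤ r * Δ k := h1
      _ ≤ r * (Δ K / r ^ K * r ^ k) := by gcongr
      _ = _ := by ring

theorem dist_cluster_le_of_kl {X : Type*} [PseudoMetricSpace X] {x : ℕ → X} {s Δ : ℕ → ℝ}
    {q θ a B C : ℝ} {xb : X} (hq : 1 < q) (hθ : θ ∈ Ico ((q - 1) / q) 1) (ha : 0 < a)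
    (hB : 0 < B) (hC : 0 < C) (hs : ∀ k, 0 < s k) (hΔ : ∀ k, 0 < Δ k)
    (hΔ0 : Tendsto Δ atTop (𝓝 0)) (hdec : ∀ k, a * s k ^ q ≤ Δ k - Δ (k + 1))
    (hkl : ∀ᶠ k in atTop, Δ (k + 1) ^ θ ≤ C * s k ^ (q - 1))
    (hx : ∀ᶠ k in atTop, dist (x k) (x (k + 1)) ≤ B * s k) (hxb : MapClusterPt xb atTop x) :
    ∃ M : ℝ, 0 < M ∧ ∀ᶠ k in atTop, dist (x (k + 1)) xb ≤ M * Δ k ^ (1 - θ) := by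
  have hq0 : 0 < q := by linarith
  have hθ0 : 0 < θ := lt_of_lt_of_le (div_pos (by linarith) hq0) hθ.1
  have hθ1 : 0 < 1 - θ := sub_pos.2 hθ.2
  set D := C / (a * (1 - θ)) with hD
  have hDpos : 0 < D := by positivity
  set E : ℕ → ℝ := fun k => (q - 1) * s k + D * Δ (k + 1) ^ (1 - θ) with hE
  have hE0 : ∀ k, 0 ≤ E k := fun k => by
    have := hs k; have := hΔ (k + 1); have : 0 < q - 1 := by linarith
    positivity
  obtain ⟨K, hK⟩ := eventually_atTop.1 (hkl.and hx)
  have hstep : ∀ k, K ≤ k → s (k + 1) ≤ E k - E (k + 1) := fun k hk => by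
    have := kl_step_length_le hq hθ0.le hθ.2 ha (hs k) (hs (k + 1)).le (hΔ (k + 1))
      (hΔ (k + 1 + 1)) (hdec (k + 1)) (hK k hk).1
    simp only [hE]
    linarith
  have htail : ∀ k, K ≤ k → ∀ n, dist (x (k + 1)) (x (k + 1 + n)) ≤ B * (E k - E (k + n)) := by
    intro k hk n
    induction n with
    | zero => simp
    | succ n ih =>
      have h1 := (hK (k + n + 1) (by omega)).2
      have h2 := hstep (k + n) (by omega)
      have h3 := dist_triangle (x (k + 1)) (x (k + 1 + n)) (x (k + 1 + (n + 1)))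
      have e1 : k + n + 1 = k + 1 + n := by ring
      have e2 : k + n + 1 + 1 = k + 1 + (n + 1) := by ring
      have e3 : k + (n + 1) = k + n + 1 := by ring
      rw [e2, e1] at h1
      rw [e3]
      have h4 := mul_le_mul_of_nonneg_left h2 hB.le
      rw [e1] at h4 ⊢
      linarith
  have hlim : ∀ k, K ≤ k → dist (x (k + 1)) xb ≤ B * E k := by
    intro k hk
    have : xb ∈ closedBall (x (k + 1)) (B * E k) := by
      refine isClosed_closedBall.mem_of_mapClusterPt hxb ?_
      filter_upwards [eventually_ge_atTop (k + 1)] with m hm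
      obtain ⟨n, rfl⟩ := Nat.exists_eq_add_of_le hm
      rw [mem_closedBall, dist_comm]
      refine (htail k hk n).trans ?_
      gcongr
      linarith [hE0 (k + n)]
    rwa [mem_closedBall, dist_comm] at this
  have hMpos : 0 < (q - 1) * (1 / a) ^ (1 / q) + D := by
    have : 0 < q - 1 := by linarith
    positivity
  refine ⟨B * ((q - 1) * (1 / a) ^ (1 / q) + D), by positivity, ?_⟩
  filter_upwards [eventually_ge_atTop K, hΔ0.eventually (gt_mem_nhds zero_lt_one)] with k hk hk1
  refine (hlim k hk).trans ?_
  rw [mul_assoc]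
  gcongr
  have hasq : 0 < a * s k ^ q := mul_pos ha (rpow_pos_of_pos (hs k) q)
  have h1 : s k ≤ (1 / a) ^ (1 / q) * Δ k ^ (1 - θ) := by
    have h2 : s k ^ q ≤ 1 / a * Δ k := by
      rw [one_div, inv_mul_eq_div, le_div_iff₀ ha]
      linarith [hdec k, hΔ (k + 1)]
    calc s k = (s k ^ q) ^ (1 / q) := by
          rw [← rpow_mul (hs k).le, mul_one_div_cancel hq0.ne', rpow_one]
      _ ≤ (1 / a * Δ k) ^ (1 / q) :=
          rpow_le_rpow (rpow_nonneg (hs k).le _) h2 (by positivity)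
      _ = (1 / a) ^ (1 / q) * Δ k ^ (1 / q) := mul_rpow (by positivity) (hΔ k).le
      _ ≤ _ := by
          gcongr ?_ * ?_
          refine rpow_le_rpow_of_exponent_ge (hΔ k) hk1.le ?_
          have := hθ.1
          rw [sub_div, div_self hq0.ne'] at this
          linarith
  have h3 : Δ (k + 1) ^ (1 - θ) ≤ Δ k ^ (1 - θ) :=
    rpow_le_rpow (hΔ _).le (by linarith [hdec k]) hθ1.le
  calc E k ≤ (q - 1) * ((1 / a) ^ (1 / q) * Δ k ^ (1 - θ)) + D * Δ k ^ (1 - θ) := by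
        simp only [hE]
        have : 0 < q - 1 := by linarith
        gcongr
    _ = _ := by ring

theorem tendsto_and_rate_of_kl {X : Type*} [PseudoMetricSpace X] {x : ℕ → X} {s Δ : ℕ → ℝ}
    {q θ a B C : ℝ} {xb : X} (hq : 1 < q) (hθ : θ ∈ Ico ((q - 1) / q) 1) (ha : 0 < a)
    (hB : 0 < B) (hC : 0 < C) (hs : ∀ k, 0 < s k) (hΔ : ∀ k, 0 < Δ k)
    (hΔ0 : Tendsto Δ atTop (𝓝 0)) (hdec : ∀ k, a * s k ^ q ≤ Δ k - Δ (k + 1))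
    (hkl : ∀ᶠ k in atTop, Δ (k + 1) ^ θ ≤ C * s k ^ (q - 1))
    (hx : ∀ᶠ k in atTop, dist (x k) (x (k + 1)) ≤ B * s k) (hxb : MapClusterPt xb atTop x) :
    Tendsto x atTop (𝓝 xb) ∧
      ∃ α : ℝ, 0 < α ∧ ∃ ρ ∈ Set.Ioo (0:ℝ) 1, ∃ K : ℕ, ∀ k : ℕ, K ≤ k →
        (θ = (q - 1) / q → dist (x k) xb ≤ α * ρ ^ k) ∧
        ((q - 1) / q < θ →
          dist (x k) xb ≤ α * (k : ℝ) ^ ((1 - θ) / (1 - q * θ / (q - 1)))) := by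
  have hq0 : 0 < q := by linarith
  have hq1 : 0 < q - 1 := by linarith
  have hθ1 : 0 < 1 - θ := sub_pos.2 hθ.2
  obtain ⟨M, hM, hMx⟩ := dist_cluster_le_of_kl hq hθ ha hB hC hs hΔ hΔ0 hdec hkl hx hxb
  refine ⟨?_, ?_⟩
  · rw [← tendsto_add_atTop_iff_nat 1, tendsto_iff_dist_tendsto_zero]
    refine squeeze_zero' (Eventually.of_forall fun _ => dist_nonneg) hMx ?_
    have := (hΔ0.rpow_const (p := 1 - θ) (Or.inr hθ1.le)).const_mul M
    simpa [zero_rpow hθ1.ne'] using this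
  set p := q * θ / (q - 1) with hp
  have hrec : ∀ᶠ k in atTop, Δ (k + 1) ^ p ≤ C ^ (q / (q - 1)) / a * (Δ k - Δ (k + 1)) := by
    filter_upwards [hkl] with k hk
    have h1 : Δ (k + 1) ^ p = (Δ (k + 1) ^ θ) ^ (q / (q - 1)) := by
      rw [← rpow_mul (hΔ _).le, hp]; congr 1; ring
    have h2 : (C * s k ^ (q - 1)) ^ (q / (q - 1)) = C ^ (q / (q - 1)) * s k ^ q := by
      rw [mul_rpow hC.le (rpow_nonneg (hs k).le _), ← rpow_mul (hs k).le,
        mul_div_cancel₀ _ hq1.ne']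
    rw [h1]
    calc _ ≤ (C * s k ^ (q - 1)) ^ (q / (q - 1)) :=
          rpow_le_rpow (rpow_nonneg (hΔ _).le _) hk (by positivity)
      _ = C ^ (q / (q - 1)) / a * (a * s k ^ q) := by rw [h2]; field_simp
      _ ≤ _ := by gcongr; exact hdec k
  have hC' : 0 < C ^ (q / (q - 1)) / a := by positivity
  obtain ⟨K, hK⟩ := eventually_atTop.1 (hrec.and hMx)
  rcases hθ.1.eq_or_lt with heq | hlt
  · have hp1 : p = 1 := by rw [hp, ← heq]; field_simp
    obtain ⟨A, hA, r, ⟨hr0, hr1⟩, hAr⟩ := exists_le_mul_pow_of_recursion (K := K) hC'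
      (fun k _ => hΔ k) (fun k hk => by simpa [hp1] using (hK k hk).1)
    have hρ0 : 0 < r ^ (1 - θ) := by positivity
    refine ⟨M * A ^ (1 - θ) / r ^ (1 - θ), by positivity, r ^ (1 - θ),
      ⟨hρ0, rpow_lt_one hr0.le hr1 hθ1⟩, K + 1, fun k hk => ⟨fun _ => ?_, fun h => ?_⟩⟩
    · obtain ⟨k, rfl⟩ : ∃ m, k = m + 1 := ⟨k - 1, by omega⟩
      have hk' : K ≤ k := by omega
      refine (hK k hk').2.trans ?_
      calc M * Δ k ^ (1 - θ) ≤ M * (A * r ^ k) ^ (1 - θ) := by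
            gcongr
            · exact (hΔ k).le
            · exact hAr k hk'
        _ = M * (A ^ (1 - θ) * (r ^ (1 - θ)) ^ k) := by
            rw [mul_rpow hA.le (by positivity), ← rpow_natCast, ← rpow_natCast, ← rpow_mul hr0.le,
              ← rpow_mul hr0.le, mul_comm (k : ℝ)]
        _ = _ := by rw [pow_succ]; field_simp
    · exact absurd heq h.ne
  · have hp1 : 1 < p := by
      rw [div_lt_iff₀ hq0] at hlt
      rw [hp, lt_div_iff₀ hq1]; linarith
    obtain ⟨A, hA, hAr⟩ := exists_le_mul_rpow_neg_of_recursion (K := K + 1) hp1 hC' (by omega)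
      (fun k hk => (hK k (by omega)).1)
    set γ := (1 - θ) / (p - 1) with hγ
    have hp1' : 0 < p - 1 := by linarith
    have hγ0 : 0 < γ := by positivity
    refine ⟨M * A ^ (1 - θ) * 2 ^ γ, by positivity, 1 / 2, by norm_num, K + 2,
      fun k hk => ⟨fun h => absurd h hlt.ne', fun _ => ?_⟩⟩
    obtain ⟨k, rfl⟩ : ∃ m, k = m + 1 := ⟨k - 1, by omega⟩
    have hexp : (1 - θ) / (1 - p) = -γ := by
      rw [hγ, ← neg_sub p 1, div_neg]
    have hk1 : (1 : ℝ) ≤ k := by exact_mod_cast (by omega : 1 ≤ k)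
    have hk0 : (0 : ℝ) < k := by linarith
    rw [hexp]
    push_cast
    refine (hK k (by omega)).2.trans ?_
    calc M * Δ k ^ (1 - θ) ≤ M * (A * (k : ℝ) ^ (-(1 / (p - 1)))) ^ (1 - θ) := by
          gcongr
          · exact (hΔ k).le
          · exact hAr k (by omega)
      _ = M * A ^ (1 - θ) * (k : ℝ) ^ (-γ) := by
          rw [mul_rpow hA.le (by positivity), ← rpow_mul hk0.le, hγ, mul_assoc]
          congr 3; ring
      _ = M * A ^ (1 - θ) * (2 ^ γ * (2 * (k : ℝ)) ^ (-γ)) := by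
          rw [mul_rpow (by norm_num) hk0.le, ← mul_assoc (2 ^ γ), ← rpow_add (by norm_num)]
          simp
      _ ≤ M * A ^ (1 - θ) * (2 ^ γ * ((k : ℝ) + 1) ^ (-γ)) := by
          gcongr M * A ^ (1 - θ) * (2 ^ γ * ?_)
          exact rpow_le_rpow_of_nonpos (by positivity) (by linarith) (by linarith)
      _ = _ := by ring

theorem exists_uniform_ball_of_isCompact {X : Type*} [PseudoMetricSpace X] {S : Set X}
    (hS : IsCompact S) {Q : Set X → ℝ → Prop}
    (hmono : ∀ s t : Set X, ∀ M M' : ℝ, 0 < M → s ⊆ t → M ≤ M' → Q t M → Q s M')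
    (hloc : ∀ z ∈ S, ∃ δ : ℝ, 0 < δ ∧ ∃ M : ℝ, 0 < M ∧ Q (ball z δ) M) :
    ∃ δ : ℝ, 0 < δ ∧ ∃ M : ℝ, 0 < M ∧ ∀ z ∈ S, Q (ball z δ) M := by
  refine hS.induction_on (p := fun T => ∃ δ : ℝ, 0 < δ ∧ ∃ M : ℝ, 0 < M ∧ ∀ z ∈ T, Q (ball z δ) M)
    ⟨1, one_pos, 1, one_pos, by simp⟩ ?_ ?_ ?_
  · rintro s t hst ⟨δ, hδ, M, hM, h⟩
    exact ⟨δ, hδ, M, hM, fun z hz => h z (hst hz)⟩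
  · rintro s t ⟨δ, hδ, M, hM, h⟩ ⟨δ', hδ', M', hM', h'⟩
    refine ⟨min δ δ', lt_min hδ hδ', max M M', lt_max_of_lt_left hM, fun z hz => ?_⟩
    rcases hz with hz | hz
    · exact hmono _ _ _ _ hM (ball_subset_ball (min_le_left _ _)) (le_max_left _ _) (h z hz)
    · exact hmono _ _ _ _ hM' (ball_subset_ball (min_le_right _ _)) (le_max_right _ _) (h' z hz)
  · intro z hz
    obtain ⟨δ, hδ, M, hM, h⟩ := hloc z hz
    refine ⟨ball z (δ / 2), mem_nhdsWithin_of_mem_nhds (ball_mem_nhds z (half_pos hδ)), δ / 2,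
      half_pos hδ, M, hM, fun z' hz' => ?_⟩
    refine hmono _ _ _ _ hM (ball_subset_ball' ?_) le_rfl h
    linarith [mem_ball.1 hz']

theorem eventually_exists_dist_mapClusterPt_lt {X : Type*} [MetricSpace X] {x : ℕ → X} {S : Set X}
    (hS : IsCompact S) (hxS : ∀ k, x k ∈ S) {ε : ℝ} (hε : 0 < ε) :
    ∀ᶠ k in atTop, ∃ z, MapClusterPt z atTop x ∧ dist (x k) z < ε := by
  by_contra hcon
  have hfreq : ∃ᶠ k in atTop, x k ∈ S \ thickening ε {z | MapClusterPt z atTop x} := by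
    refine (not_eventually.1 hcon).mono fun k hk => ⟨hxS k, fun hmem => hk ?_⟩
    obtain ⟨z, hz, hd⟩ := mem_thickening_iff.1 hmem
    exact ⟨z, hz, hd⟩
  obtain ⟨z, hz, hzc⟩ := (hS.diff isOpen_thickening).exists_mapClusterPt_of_frequently hfreq
  exact hz.2 (self_subset_thickening hε _ hzc)

theorem isCompact_setOf_mapClusterPt {X : Type*} [MetricSpace X] {x : ℕ → X} {S : Set X}
    (hS : IsCompact S) (hxS : ∀ k, x k ∈ S) : IsCompact {z | MapClusterPt z atTop x} :=
  hS.of_isClosed_subset isClosed_setOfPred_clusterPt fun _ hz =>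
    hS.isClosed.mem_of_mapClusterPt hz (Eventually.of_forall hxS)

theorem LowerSemicontinuous.le_coe_of_tendsto {X ι : Type*} [TopologicalSpace X] {g : X → EReal}
    (hg : LowerSemicontinuous g) {l : Filter ι} [NeBot l] {u : ι → X} {b : ι → ℝ} {z : X} {b₀ : ℝ}
    (hu : Tendsto u l (𝓝 z)) (hb : Tendsto b l (𝓝 b₀)) (h : ∀ᶠ i in l, g (u i) ≤ b i) :
    g z ≤ b₀ := by
  by_contra! hlt
  obtain ⟨c, hc1, hc2⟩ := EReal.lt_iff_exists_real_btwn.1 hlt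
  have h1 := hu.eventually (hg z c hc2)
  have h2 := hb.eventually (gt_mem_nhds (EReal.coe_lt_coe_iff.1 hc1))
  obtain ⟨i, hi1, hi2, hi3⟩ := (h1.and (h2.and h)).exists
  exact absurd (hi1.trans_le hi3) (not_lt.2 (EReal.coe_le_coe_iff.2 hi2.le))

theorem ne_top_of_isProx {X : Type*} [NormedAddCommGroup X] {g : X → EReal}
    (hproper : ∃ z, g z ≠ ⊤) {w p : X}
    (hp : ∀ z, ((1 / 2 * ‖p - w‖ ^ 2 : ℝ) : EReal) + g p ≤
      ((1 / 2 * ‖z - w‖ ^ 2 : ℝ) : EReal) + g z) : g p ≠ ⊤ := by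
  obtain ⟨z, hz⟩ := hproper
  intro hpt
  have h := hp z
  rw [hpt, EReal.coe_add_top, top_le_iff] at h
  exact (EReal.add_ne_top (EReal.coe_ne_top _) hz) h

section Subdifferential

variable {X : Type*} [NormedAddCommGroup X] [InnerProductSpace ℝ X]

theorem toReal_add_inner_le_of_mem_ESubdiff {g : X → EReal} (hbot : ∀ z, g z ≠ ⊥) {p u z : X}
    (hu : u ∈ ESubdiff g p) (hz : g z ≠ ⊤) :
    (g p).toReal + ⟪u, z - p⟫_ℝ ≤ (g z).toReal := by
  have h := hu z
  have hp : g p ≠ ⊤ := by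
    intro hp
    rw [hp, EReal.top_add_coe, top_le_iff] at h
    exact hz h
  rw [← EReal.coe_toReal hp (hbot p), ← EReal.coe_toReal hz (hbot z)] at h
  exact_mod_cast h

theorem mem_ESubdiff_of_forall_toReal {g : X → EReal} (hbot : ∀ z, g z ≠ ⊥) {p u : X}
    (hp : g p ≠ ⊤) (h : ∀ z, g z ≠ ⊤ → (g p).toReal + ⟪u, z - p⟫_ℝ ≤ (g z).toReal) :
    u ∈ ESubdiff g p := by
  intro z
  by_cases hz : g z = ⊤
  · rw [hz]; exact le_top
  · rw [← EReal.coe_toReal hp (hbot p), ← EReal.coe_toReal hz (hbot z)]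
    exact_mod_cast h z hz

theorem sub_mem_ESubdiff_of_isProx {g : X → EReal} (hproper : ∃ z, g z ≠ ⊤)
    (hbot : ∀ z, g z ≠ ⊥)
    (hconv : ∀ u w : X, ∀ t : ℝ, t ∈ Set.Ioo (0:ℝ) 1 →
      g (t • u + (1 - t) • w) ≤ (t : EReal) * g u + ((1 - t : ℝ) : EReal) * g w) {w p : X}
    (hp : ∀ z, ((1 / 2 * ‖p - w‖ ^ 2 : ℝ) : EReal) + g p ≤
      ((1 / 2 * ‖z - w‖ ^ 2 : ℝ) : EReal) + g z) : w - p ∈ ESubdiff g p := by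
  have hpt := ne_top_of_isProx hproper hp
  refine mem_ESubdiff_of_forall_toReal hbot hpt fun z hz => ?_
  have key : ∀ t ∈ Ioo (0 : ℝ) 1,
      (g p).toReal - (g z).toReal ≤ ⟪p - w, z - p⟫_ℝ + t / 2 * ‖z - p‖ ^ 2 := by
    intro t ht
    have h1 := (hp (t • z + (1 - t) • p)).trans (add_le_add_right (hconv z p t ht) _)
    rw [← EReal.coe_toReal hpt (hbot p), ← EReal.coe_toReal hz (hbot z)] at h1
    norm_cast at h1
    have h2 : t • z + (1 - t) • p - w = (p - w) + t • (z - p) := by module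
    rw [h2, norm_add_sq_real, norm_smul, inner_smul_right, mul_pow, norm_eq_abs, sq_abs] at h1
    refine le_of_mul_le_mul_left ?_ ht.1
    nlinarith
  have hneg : ⟪w - p, z - p⟫_ℝ = -⟪p - w, z - p⟫_ℝ := by rw [← inner_neg_left, neg_sub]
  have hlim : Tendsto (fun t : ℝ => ⟪p - w, z - p⟫_ℝ + t / 2 * ‖z - p‖ ^ 2) (𝓝[>] 0)
      (𝓝 (⟪p - w, z - p⟫_ℝ + 0 / 2 * ‖z - p‖ ^ 2)) :=
    (Continuous.tendsto (by fun_prop) 0).mono_left nhdsWithin_le_nhds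
  have := ge_of_tendsto hlim (Filter.mem_of_superset (Ioo_mem_nhdsGT one_pos) key)
  rw [hneg]
  linarith

end Subdifferential

/-- `f` is twice differentiable on `U` with gradient `f'` and Hessian `f''`; its values, gradients
and Hessians are bounded by `M` on `U`, and its Hessian is `M`-Lipschitz on `U`. -/
structure HessianLipschitzBoundOn {X : Type*} [NormedAddCommGroup X] [InnerProductSpace ℝ X]
    [CompleteSpace X] (f : X → ℝ) (f' : X → X) (f'' : X → X →L[ℝ] X) (U : Set X) (M : ℝ) :
    Prop where
  hasGradientAt : ∀ z ∈ U, HasGradientAt f (f' z) z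
  hasFDerivAt : ∀ z ∈ U, HasFDerivAt f' (f'' z) z
  lipschitz : ∀ a ∈ U, ∀ b ∈ U, ‖f'' a - f'' b‖ ≤ M * ‖a - b‖
  norm_hessian_le : ∀ z ∈ U, ‖f'' z‖ ≤ M
  norm_gradient_le : ∀ z ∈ U, ‖f' z‖ ≤ M
  abs_le : ∀ z ∈ U, |f z| ≤ M

theorem abs_sub_le_of_norm_gradient_le {X : Type*} [NormedAddCommGroup X] [InnerProductSpace ℝ X]
    [CompleteSpace X] {f : X → ℝ} {f' : X → X} {s : Set X} {M : ℝ} (hs : Convex ℝ s)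
    (hf : ∀ z ∈ s, HasGradientAt f (f' z) z) (hM : ∀ z ∈ s, ‖f' z‖ ≤ M) {a b : X} (ha : a ∈ s)
    (hb : b ∈ s) : |f b - f a| ≤ M * ‖b - a‖ := by
  refine hs.norm_image_sub_le_of_norm_hasFDerivWithin_le
    (fun z hz => (hf z hz).hasFDerivAt.hasFDerivWithinAt) (fun z hz => ?_) ha hb
  simpa using hM z hz

namespace HessianLipschitzBoundOn

variable {X : Type*} [NormedAddCommGroup X] [InnerProductSpace ℝ X] [CompleteSpace X]
  {f : X → ℝ} {f' : X → X} {f'' : X → X →L[ℝ] X} {U V : Set X} {M M' : ℝ}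

theorem mono (h : HessianLipschitzBoundOn f f' f'' V M) (hUV : U ⊆ V) (hM : M ≤ M') :
    HessianLipschitzBoundOn f f' f'' U M' where
  hasGradientAt z hz := h.hasGradientAt z (hUV hz)
  hasFDerivAt z hz := h.hasFDerivAt z (hUV hz)
  lipschitz a ha b hb := (h.lipschitz a (hUV ha) b (hUV hb)).trans (by gcongr)
  norm_hessian_le z hz := (h.norm_hessian_le z (hUV hz)).trans hM
  norm_gradient_le z hz := (h.norm_gradient_le z (hUV hz)).trans hM
  abs_le z hz := (h.abs_le z (hUV hz)).trans hM

theorem abs_sub_le (h : HessianLipschitzBoundOn f f' f'' U M) (hU : Convex ℝ U) {a b : X}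
    (ha : a ∈ U) (hb : b ∈ U) : |f b - f a| ≤ M * ‖b - a‖ :=
  abs_sub_le_of_norm_gradient_le hU h.hasGradientAt h.norm_gradient_le ha hb

theorem norm_gradient_sub_le (h : HessianLipschitzBoundOn f f' f'' U M) (hU : Convex ℝ U)
    {a b : X} (ha : a ∈ U) (hb : b ∈ U) : ‖f' b - f' a‖ ≤ M * ‖b - a‖ :=
  hU.norm_image_sub_le_of_norm_hasFDerivWithin_le
    (fun z hz => (h.hasFDerivAt z hz).hasFDerivWithinAt) h.norm_hessian_le ha hb

theorem norm_gradient_sub_sub_le (h : HessianLipschitzBoundOn f f' f'' U M) (hU : Convex ℝ U)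
    (hM : 0 ≤ M) {a b : X} (ha : a ∈ U) (hb : b ∈ U) :
    ‖f' b - f' a - f'' a (b - a)‖ ≤ M * ‖b - a‖ ^ 2 := by
  have hseg : segment ℝ a b ⊆ U := hU.segment_subset ha hb
  have := (convex_segment a b).norm_image_sub_le_of_norm_hasFDerivWithin_le' (φ := f'' a)
    (C := M * ‖b - a‖) (fun z hz => (h.hasFDerivAt z (hseg hz)).hasFDerivWithinAt)
    (fun z hz => (h.lipschitz z (hseg hz) a ha).trans (by
      gcongr
      rw [segment_eq_image'] at hz
      obtain ⟨t, ht, rfl⟩ := hz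
      rw [add_sub_cancel_left, norm_smul, norm_eq_abs, abs_of_nonneg ht.1]
      exact mul_le_of_le_one_left (norm_nonneg _) ht.2))
    (left_mem_segment ℝ a b) (right_mem_segment ℝ a b)
  rw [pow_two, ← mul_assoc]
  exact this

theorem abs_sub_taylor_le (h : HessianLipschitzBoundOn f f' f'' U M) (hU : Convex ℝ U)
    (hM : 0 ≤ M) {a b : X} (ha : a ∈ U) (hb : b ∈ U) :
    |f b - (f a + ⟪f' a, b - a⟫_ℝ + 1 / 2 * ⟪b - a, f'' a (b - a)⟫_ℝ)| ≤ M * ‖b - a‖ ^ 3 := by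
  set d := b - a with hd
  have hmem : ∀ t ∈ Icc (0 : ℝ) 1, a + t • d ∈ U := fun t ht =>
    hU.segment_subset ha hb (by rw [segment_eq_image']; exact ⟨t, ht, rfl⟩)
  set φ : ℝ → ℝ := fun t => f (a + t • d) - t * ⟪f' a, d⟫_ℝ - t ^ 2 / 2 * ⟪d, f'' a d⟫_ℝ with hφ
  have hder : ∀ t ∈ Icc (0 : ℝ) 1, HasDerivWithinAt φ
      (⟪f' (a + t • d), d⟫_ℝ - ⟪f' a, d⟫_ℝ - t * ⟪d, f'' a d⟫_ℝ) (Icc 0 1) t := by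
    intro t ht
    have h1 : HasDerivAt (fun t : ℝ => a + t • d) d t := by
      simpa using ((hasDerivAt_id t).smul_const d).const_add a
    have h2 := (h.hasGradientAt _ (hmem t ht)).hasFDerivAt.comp_hasDerivAt t h1
    have h3 : HasDerivAt (fun t : ℝ => t * ⟪f' a, d⟫_ℝ) ⟪f' a, d⟫_ℝ t := by
      simpa using (hasDerivAt_id t).mul_const ⟪f' a, d⟫_ℝ
    have h4 : HasDerivAt (fun t : ℝ => t ^ 2 / 2 * ⟪d, f'' a d⟫_ℝ) (t * ⟪d, f'' a d⟫_ℝ) t := by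
      have := (((hasDerivAt_id t).pow 2).div_const 2).mul_const ⟪d, f'' a d⟫_ℝ
      simpa using this
    have h5 := (h2.sub h3).sub h4
    simp only [InnerProductSpace.toDual_apply_apply] at h5
    exact h5.hasDerivWithinAt
  have hbound : ∀ t ∈ Icc (0 : ℝ) 1,
      ‖⟪f' (a + t • d), d⟫_ℝ - ⟪f' a, d⟫_ℝ - t * ⟪d, f'' a d⟫_ℝ‖ ≤ M * ‖d‖ ^ 3 := by
    intro t ht
    have h1 := h.norm_gradient_sub_sub_le hU hM ha (hmem t ht)
    rw [add_sub_cancel_left, map_smul, norm_smul, norm_eq_abs, abs_of_nonneg ht.1] at h1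
    have h2 : ⟪f' (a + t • d), d⟫_ℝ - ⟪f' a, d⟫_ℝ - t * ⟪d, f'' a d⟫_ℝ
        = ⟪f' (a + t • d) - f' a - t • f'' a d, d⟫_ℝ := by
      rw [inner_sub_left (f' (a + t • d) - f' a), inner_sub_left (f' (a + t • d)),
        real_inner_smul_left, real_inner_comm d (f'' a d)]
    rw [h2]
    calc _ ≤ ‖f' (a + t • d) - f' a - t • f'' a d‖ * ‖d‖ := norm_inner_le_norm _ _
      _ ≤ M * (t * ‖d‖) ^ 2 * ‖d‖ := by gcongr
      _ ≤ M * (1 * ‖d‖) ^ 2 * ‖d‖ := by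
          have := ht.1
          gcongr
          exact ht.2
      _ = _ := by ring
  have := (convex_Icc (0 : ℝ) 1).norm_image_sub_le_of_norm_hasDerivWithin_le hder hbound
    (left_mem_Icc.2 zero_le_one) (right_mem_Icc.2 zero_le_one)
  simp only [hφ, norm_eq_abs] at this
  have e : a + (1 : ℝ) • d = b := by rw [hd, one_smul]; abel
  rw [e] at this
  norm_num at this
  convert this using 2
  ring

end HessianLipschitzBoundOn

theorem exists_tendsto_lt_of_sufficient_decrease {q a m : ℝ} (hq : 0 < q) (ha : 0 < a)
    {φ s : ℕ → ℝ} (hs : ∀ k, 0 < s k) (hm : ∀ k, m ≤ φ k)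
    (hdec : ∀ k, a * s k ^ q ≤ φ k - φ (k + 1)) :
    ∃ l : ℝ, Tendsto φ atTop (𝓝 l) ∧ (∀ k, l < φ k) ∧ Tendsto s atTop (𝓝 0) := by
  have hlt : ∀ k, φ (k + 1) < φ k := fun k => by
    have := mul_pos ha (rpow_pos_of_pos (hs k) q)
    linarith [hdec k]
  have hanti : Antitone φ := antitone_nat_of_succ_le fun k => (hlt k).le
  have hbdd : BddBelow (range φ) := ⟨m, by rintro _ ⟨k, rfl⟩; exact hm k⟩
  have hlim := tendsto_atTop_ciInf hanti hbdd
  refine ⟨_, hlim, fun k => (ciInf_le hbdd (k + 1)).trans_lt (hlt k), ?_⟩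
  have h1 : Tendsto (fun k => s k ^ q) atTop (𝓝 0) := by
    have h2 : Tendsto (fun k => 1 / a * (φ k - φ (k + 1))) atTop (𝓝 0) := by
      simpa using (hlim.sub (hlim.comp (tendsto_add_atTop_nat 1))).const_mul (1 / a)
    refine squeeze_zero (fun k => rpow_nonneg (hs k).le q) (fun k => ?_) h2
    rw [one_div, inv_mul_eq_div, le_div_iff₀ ha]
    linarith [hdec k]
  have h2 := h1.rpow_const (p := 1 / q) (Or.inr (by positivity))
  rw [zero_rpow (by positivity)] at h2
  refine h2.congr fun k => ?_
  rw [← rpow_mul (hs k).le, mul_one_div_cancel hq.ne', rpow_one]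

theorem stationary_and_eq_limit_of_mapClusterPt {X : Type*} [NormedAddCommGroup X]
    [InnerProductSpace ℝ X] {f : X → ℝ} {g : X → EReal} {f' : X → X} (hbot : ∀ z, g z ≠ ⊥)
    (hlsc : LowerSemicontinuous g) {x p u : ℕ → X} {l : ℝ} {z : X}
    (hxD : ∀ k, g (x k) ≠ ⊤) (hpD : ∀ k, g (p k) ≠ ⊤) (hu : ∀ k, u k ∈ ESubdiff g (p k))
    (hl : Tendsto (fun k => f (x k) + (g (x k)).toReal) atTop (𝓝 l))
    (hpx : Tendsto (fun k => p k - x k) atTop (𝓝 0))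
    (hgrad : Tendsto (fun k => f' (p k) + u k) atTop (𝓝 0))
    (hFp : ∀ k, f (x (k + 1)) + (g (x (k + 1))).toReal ≤ f (p k) + (g (p k)).toReal)
    (hz : MapClusterPt z atTop x) (hzD : g z ≠ ⊤) (hf : ContinuousAt f z)
    (hf' : ContinuousAt f' z) :
    -f' z ∈ ESubdiff g z ∧ f z + (g z).toReal = l := by
  obtain ⟨ψ, hψ, hxψ⟩ := hz.tendsto_subseq
  have hpψ : Tendsto (fun i => p (ψ i)) atTop (𝓝 z) := by
    simpa using (hpx.comp hψ.tendsto_atTop).add hxψ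
  have huψ : Tendsto (fun i => u (ψ i)) atTop (𝓝 (-f' z)) := by
    simpa using (hgrad.comp hψ.tendsto_atTop).sub (hf'.tendsto.comp hpψ)
  have hub : ∀ w, g w ≠ ⊤ → ∀ i,
      (g (p (ψ i))).toReal ≤ (g w).toReal - ⟪u (ψ i), w - p (ψ i)⟫_ℝ := fun w hw i => by
    linarith [toReal_add_inner_le_of_mem_ESubdiff hbot (hu (ψ i)) hw]
  have hublim : ∀ w, Tendsto (fun i => (g w).toReal - ⟪u (ψ i), w - p (ψ i)⟫_ℝ) atTop
      (𝓝 ((g w).toReal - ⟪-f' z, w - z⟫_ℝ)) := fun w =>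
    tendsto_const_nhds.sub (huψ.inner (tendsto_const_nhds.sub hpψ))
  refine ⟨mem_ESubdiff_of_forall_toReal hbot hzD fun w hw => ?_, le_antisymm ?_ ?_⟩
  · have h1 := hlsc.le_coe_of_tendsto hpψ (hublim w) (Eventually.of_forall fun i => by
      rw [← EReal.coe_toReal (hpD (ψ i)) (hbot _)]
      exact EReal.coe_le_coe_iff.2 (hub w hw i))
    rw [← EReal.coe_toReal hzD (hbot z), EReal.coe_le_coe_iff] at h1
    linarith
  · have h1 := hlsc.le_coe_of_tendsto hxψ
      ((hl.comp hψ.tendsto_atTop).sub (hf.tendsto.comp hxψ)) (Eventually.of_forall fun i => by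
      rw [Function.comp_apply, ← EReal.coe_toReal (hxD (ψ i)) (hbot _)]
      exact EReal.coe_le_coe_iff.2 (by simp))
    rw [← EReal.coe_toReal hzD (hbot z), EReal.coe_le_coe_iff] at h1
    linarith
  · have h1 := (hl.comp (tendsto_add_atTop_nat 1)).comp hψ.tendsto_atTop
    have h2 := (hf.tendsto.comp hpψ).add (hublim z)
    have h3 := le_of_tendsto_of_tendsto' h1 h2 fun i =>
      (hFp (ψ i)).trans (add_le_add_right (hub z hzD i) _)
    simpa using h3

theorem exists_uniform_kl_of_isCompact {X : Type*} [NormedAddCommGroup X]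
    [InnerProductSpace ℝ X] {f : X → ℝ} {g : X → EReal} {f' : X → X} (hbot : ∀ z, g z ≠ ⊥)
    {F : X → EReal} (hF : ∀ z, F z = (f z : EReal) + g z) {θ : ℝ}
    (hKL : ∀ xc : X, (ESubdiff g xc).Nonempty →
        ∃ δ : ℝ, 0 < δ ∧ ∃ ϖ : EReal, 0 < ϖ ∧ ∃ c : ℝ, 0 < c ∧
          ∀ z ∈ Metric.ball xc δ, F xc < F z → F z < F xc + ϖ →
            ∀ w ∈ ESubdiff g z,
              1 ≤ c * (1 - θ) * (F z - F xc).toReal ^ (-θ) * ‖f' z + w‖)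
    {S : Set X} (hS : IsCompact S) {l : ℝ} (hSD : ∀ z ∈ S, g z ≠ ⊤)
    (hSsub : ∀ z ∈ S, (ESubdiff g z).Nonempty) (hSl : ∀ z ∈ S, f z + (g z).toReal = l) :
    ∃ δ : ℝ, 0 < δ ∧ ∃ M : ℝ, 0 < M ∧ ∀ xc ∈ S, ∀ z ∈ ball xc δ, g z ≠ ⊤ →
      l < f z + (g z).toReal → f z + (g z).toReal < l + 1 / M → ∀ w ∈ ESubdiff g z,
        1 ≤ M * (f z + (g z).toReal - l) ^ (-θ) * ‖f' z + w‖ := by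
  have hFr : ∀ z, g z ≠ ⊤ → F z = ((f z + (g z).toReal : ℝ) : EReal) := fun z hz => by
    rw [hF, EReal.coe_add, EReal.coe_toReal hz (hbot z)]
  refine exists_uniform_ball_of_isCompact hS (Q := fun U M => ∀ z ∈ U, g z ≠ ⊤ →
    l < f z + (g z).toReal → f z + (g z).toReal < l + 1 / M → ∀ w ∈ ESubdiff g z,
      1 ≤ M * (f z + (g z).toReal - l) ^ (-θ) * ‖f' z + w‖) ?_ ?_
  · intro s t M M' hM hst hMM' h z hz hzD h1 h2 w hw
    have h3 : 1 / M' ≤ 1 / M := one_div_le_one_div_of_le hM hMM'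
    refine (h z (hst hz) hzD h1 (by linarith) w hw).trans ?_
    have : 0 ≤ (f z + (g z).toReal - l) ^ (-θ) := rpow_nonneg (by linarith) _
    gcongr
  · intro xc hxc
    obtain ⟨δ, hδ, ϖ, hϖ, c, -, h⟩ := hKL xc (hSsub xc hxc)
    obtain ⟨ϖ', hϖ0, hϖ'⟩ := EReal.lt_iff_exists_real_btwn.1 hϖ
    have hϖ0' : 0 < ϖ' := by exact_mod_cast hϖ0
    have hFxc : F xc = (l : EReal) := by rw [hFr xc (hSD xc hxc), hSl xc hxc]
    refine ⟨δ, hδ, max (c * (1 - θ)) (1 / ϖ'), lt_max_of_lt_right (by positivity), ?_⟩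
    intro z hz hzD h1 h2 w hw
    have h3 : 1 / max (c * (1 - θ)) (1 / ϖ') ≤ ϖ' := by
      rw [one_div_le (lt_max_of_lt_right (by positivity)) hϖ0']
      exact le_max_right _ _
    have h4 := h z hz (by rw [hFxc, hFr z hzD]; exact_mod_cast h1) (by
      rw [hFxc, hFr z hzD]
      calc ((f z + (g z).toReal : ℝ) : EReal) < ((l + ϖ' : ℝ) : EReal) := by
            exact_mod_cast h2.trans_le (by linarith)
        _ = (l : EReal) + (ϖ' : EReal) := EReal.coe_add _ _
        _ ≤ _ := add_le_add_right hϖ'.le _) w hw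
    rw [hFxc, hFr z hzD, ← EReal.coe_sub, EReal.toReal_coe] at h4
    refine h4.trans ?_
    have : 0 ≤ (f z + (g z).toReal - l) ^ (-θ) := rpow_nonneg (by linarith) _
    gcongr
    exact le_max_left _ _

theorem convergence_rate_of_inexact_prox_descent {X : Type*} [NormedAddCommGroup X]
    [InnerProductSpace ℝ X] [CompleteSpace X] {f : X → ℝ} {g : X → EReal} {f' : X → X}
    {f'' : X → X →L[ℝ] X} (hbot : ∀ z, g z ≠ ⊥) (hlsc : LowerSemicontinuous g)
    {F : X → EReal} (hF : ∀ z, F z = (f z : EReal) + g z) {q θ a B C l δ M : ℝ} (hq : 1 < q)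
    (hθ : θ ∈ Ico ((q - 1) / q) 1) (ha : 0 < a) (hB : 0 < B) (hC : 0 < C)
    (hKL : ∀ xc : X, (ESubdiff g xc).Nonempty →
        ∃ δ : ℝ, 0 < δ ∧ ∃ ϖ : EReal, 0 < ϖ ∧ ∃ c : ℝ, 0 < c ∧
          ∀ z ∈ Metric.ball xc δ, F xc < F z → F z < F xc + ϖ →
            ∀ w ∈ ESubdiff g z,
              1 ≤ c * (1 - θ) * (F z - F xc).toReal ^ (-θ) * ‖f' z + w‖)
    {S : Set X} (hS : IsCompact S) {x p u : ℕ → X} {s : ℕ → ℝ} (hxS : ∀ k, x k ∈ S)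
    (hxD : ∀ k, g (x k) ≠ ⊤) (hpD : ∀ k, g (p k) ≠ ⊤) (hu : ∀ k, u k ∈ ESubdiff g (p k))
    (hcD : ∀ z, MapClusterPt z atTop x → g z ≠ ⊤) (hδ : 0 < δ)
    (hf : ∀ z, MapClusterPt z atTop x → HessianLipschitzBoundOn f f' f'' (ball z δ) M)
    (hs : ∀ k, 0 < s k) (hs0 : Tendsto s atTop (𝓝 0))
    (hl : Tendsto (fun k => f (x k) + (g (x k)).toReal) atTop (𝓝 l))
    (hlt : ∀ k, l < f (x k) + (g (x k)).toReal)
    (hdec : ∀ k, a * s k ^ q ≤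
      (f (x k) + (g (x k)).toReal) - (f (x (k + 1)) + (g (x (k + 1))).toReal))
    (hFp : ∀ k, f (x (k + 1)) + (g (x (k + 1))).toReal ≤ f (p k) + (g (p k)).toReal)
    (hpx : ∀ᶠ k in atTop, ‖p k - x k‖ ≤ B * s k)
    (hxx : ∀ᶠ k in atTop, dist (x k) (x (k + 1)) ≤ B * s k)
    (hgrad : ∀ᶠ k in atTop, ‖f' (p k) + u k‖ ≤ C * s k ^ (q - 1)) :
    ∃ xb : X, -f' xb ∈ ESubdiff g xb ∧ Tendsto x atTop (𝓝 xb) ∧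
      ∃ α : ℝ, 0 < α ∧ ∃ ρ ∈ Set.Ioo (0:ℝ) 1, ∃ K : ℕ, ∀ k : ℕ, K ≤ k →
        (θ = (q - 1) / q → dist (x k) xb ≤ α * ρ ^ k) ∧
        ((q - 1) / q < θ →
          dist (x k) xb ≤ α * (k : ℝ) ^ ((1 - θ) / (1 - q * θ / (q - 1)))) := by
  have hq0 : 0 < q := by linarith
  have hq1 : 0 < q - 1 := by linarith
  have hθ0 : 0 < θ := lt_of_lt_of_le (div_pos hq1 hq0) hθ.1
  have hBs : Tendsto (fun k => B * s k) atTop (𝓝 0) := by simpa using hs0.const_mul B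
  have hCs : Tendsto (fun k => C * s k ^ (q - 1)) atTop (𝓝 0) := by
    simpa [zero_rpow hq1.ne'] using (hs0.rpow_const (p := q - 1) (Or.inr hq1.le)).const_mul C
  have hpx0 : Tendsto (fun k => p k - x k) atTop (𝓝 0) := squeeze_zero_norm' hpx hBs
  have hgrad0 : Tendsto (fun k => f' (p k) + u k) atTop (𝓝 0) := squeeze_zero_norm' hgrad hCs
  have hclus : ∀ z, MapClusterPt z atTop x →
      -f' z ∈ ESubdiff g z ∧ f z + (g z).toReal = l := fun z hz =>
    stationary_and_eq_limit_of_mapClusterPt hbot hlsc hxD hpD hu hl hpx0 hgrad0 hFp hz (hcD z hz)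
      ((hf z hz).hasGradientAt z (mem_ball_self hδ)).continuousAt
      ((hf z hz).hasFDerivAt z (mem_ball_self hδ)).continuousAt
  have hω := isCompact_setOf_mapClusterPt hS hxS
  obtain ⟨xb, -, hxb⟩ := hS.exists_mapClusterPt
    (tendsto_principal.2 (Eventually.of_forall hxS : ∀ᶠ k in atTop, x k ∈ S))
  refine ⟨xb, (hclus xb hxb).1, ?_⟩
  obtain ⟨δ', hδ', M', hM', hKL'⟩ := exists_uniform_kl_of_isCompact hbot hF hKL hω hcD
    (fun z hz => ⟨_, (hclus z hz).1⟩) fun z hz => (hclus z hz).2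
  have hnear : ∀ᶠ k in atTop, ∃ z, MapClusterPt z atTop x ∧
      x k ∈ ball z (min δ δ') ∧ p k ∈ ball z (min δ δ') := by
    have hε : 0 < min δ δ' / 2 := half_pos (lt_min hδ hδ')
    filter_upwards [eventually_exists_dist_mapClusterPt_lt hS hxS hε,
      hpx0.eventually (ball_mem_nhds 0 hε)] with k ⟨z, hz, hzd⟩ hk
    rw [dist_zero_right, ← dist_eq_norm] at hk
    refine ⟨z, hz, mem_ball.2 (by linarith), mem_ball.2 ?_⟩
    linarith [dist_triangle (p k) (x k) z]
  have hFplt : ∀ᶠ k in atTop, f (p k) + (g (p k)).toReal < l + 1 / M' := by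
    have hlim : Tendsto (fun k => f (x k) + (g (x k)).toReal + (M + (M + 1)) * ‖p k - x k‖) atTop
        (𝓝 (l + (M + (M + 1)) * 0)) :=
      hl.add (((tendsto_zero_iff_norm_tendsto_zero.1 hpx0)).const_mul _)
    rw [mul_zero, add_zero] at hlim
    filter_upwards [hlim.eventually (gt_mem_nhds (lt_add_of_pos_right l (one_div_pos.2 hM'))),
      hnear, hgrad0.eventually (ball_mem_nhds 0 one_pos)] with k hk ⟨z, hz, hxz, hpz⟩ hk1
    refine lt_of_le_of_lt ?_ hk
    have hsub : ball z (min δ δ') ⊆ ball z δ := ball_subset_ball (min_le_left _ _)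
    have h1 := (hf z hz).abs_sub_le (convex_ball z δ) (hsub hxz) (hsub hpz)
    have h2 := toReal_add_inner_le_of_mem_ESubdiff hbot (hu k) (hxD k)
    have h3 : ‖u k‖ ≤ M + 1 := by
      have e : u k = (f' (p k) + u k) - f' (p k) := by abel
      have h4 := norm_sub_le (f' (p k) + u k) (f' (p k))
      rw [← e] at h4
      have h5 := (hf z hz).norm_gradient_le _ (hsub hpz)
      rw [dist_zero_right] at hk1
      linarith
    have h4 : -⟪u k, x k - p k⟫_ℝ ≤ (M + 1) * ‖p k - x k‖ := by
      calc -⟪u k, x k - p k⟫_ℝ ≤ |⟪u k, x k - p k⟫_ℝ| := neg_le_abs _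
        _ ≤ ‖u k‖ * ‖x k - p k‖ := abs_real_inner_le_norm _ _
        _ ≤ _ := by rw [norm_sub_rev]; gcongr
    have h5 := le_abs_self (f (p k) - f (x k))
    linarith
  have hkl : ∀ᶠ k in atTop,
      (f (x (k + 1)) + (g (x (k + 1))).toReal - l) ^ θ ≤ M' * C * s k ^ (q - 1) := by
    filter_upwards [hFplt, hnear, hgrad] with k hk ⟨z, hz, _, hpz⟩ hgk
    have hlp : l < f (p k) + (g (p k)).toReal := (hlt (k + 1)).trans_le (hFp k)
    have h1 := hKL' z hz (p k) (ball_subset_ball (min_le_right _ _) hpz) (hpD k) hlp hk (u k) (hu k)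
    have hpos : 0 < f (p k) + (g (p k)).toReal - l := by linarith
    have hθpos := rpow_pos_of_pos hpos θ
    rw [rpow_neg hpos.le] at h1
    calc (f (x (k + 1)) + (g (x (k + 1))).toReal - l) ^ θ
        ≤ (f (p k) + (g (p k)).toReal - l) ^ θ :=
          rpow_le_rpow (by linarith [hlt (k + 1)]) (by linarith [hFp k]) hθ0.le
      _ = (f (p k) + (g (p k)).toReal - l) ^ θ * 1 := (mul_one _).symm
      _ ≤ (f (p k) + (g (p k)).toReal - l) ^ θ *
          (M' * ((f (p k) + (g (p k)).toReal - l) ^ θ)⁻¹ * ‖f' (p k) + u k‖) := by gcongr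
      _ = M' * ‖f' (p k) + u k‖ := by field_simp
      _ ≤ M' * (C * s k ^ (q - 1)) := by gcongr
      _ = _ := by ring
  exact tendsto_and_rate_of_kl (Δ := fun k => f (x k) + (g (x k)).toReal - l) hq hθ ha hB
    (mul_pos hM' hC) hs (fun k => sub_pos.2 (hlt k)) (by simpa using hl.sub_const l)
    (fun k => by linarith [hdec k]) hkl hxx hxb

theorem norm_le_of_mem_ball_of_lipschitz {X Y : Type*} [NormedAddCommGroup X]
    [NormedAddCommGroup Y] {h : X → Y} {z a : X} {K δ : ℝ} (hK : 0 ≤ K) (hδ : 0 < δ)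
    (hlip : ∀ a ∈ ball z δ, ∀ b ∈ ball z δ, ‖h a - h b‖ ≤ K * ‖a - b‖) (ha : a ∈ ball z δ) :
    ‖h a‖ ≤ ‖h z‖ + K * δ := by
  have h1 := hlip a ha z (mem_ball_self hδ)
  have h2 := norm_sub_norm_le (h a) (h z)
  have h3 : K * ‖a - z‖ ≤ K * δ := by
    gcongr
    exact (mem_ball_iff_norm.1 ha).le
  linarith

theorem exists_ball_lipschitz {X Y : Type*} [NormedAddCommGroup X] [NormedAddCommGroup Y]
    {h : X → Y} {N : Set X} (hN : IsOpen N)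
    (hloc : ∀ z ∈ N, ∃ K : ℝ, 0 < K ∧ ∃ δ : ℝ, 0 < δ ∧
        ∀ a ∈ Metric.ball z δ ∩ N, ∀ b ∈ Metric.ball z δ ∩ N, ‖h a - h b‖ ≤ K * ‖a - b‖)
    {z : X} (hz : z ∈ N) :
    ∃ K : ℝ, 0 < K ∧ ∃ δ : ℝ, 0 < δ ∧
      ∀ a ∈ ball z δ, ∀ b ∈ ball z δ, ‖h a - h b‖ ≤ K * ‖a - b‖ := by
  obtain ⟨K, hK, δ, hδ, hlip⟩ := hloc z hz
  obtain ⟨ε, hε, hball⟩ := Metric.isOpen_iff.1 hN z hz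
  have hsub : ball z (min δ ε) ⊆ ball z δ ∩ N := fun a ha =>
    ⟨ball_subset_ball (min_le_left _ _) ha, hball (ball_subset_ball (min_le_right _ _) ha)⟩
  exact ⟨K, hK, min δ ε, lt_min hδ hε, fun a ha b hb => hlip a (hsub ha) b (hsub hb)⟩

theorem convex_setOf_ne_top {X : Type*} [NormedAddCommGroup X] [InnerProductSpace ℝ X]
    {g : X → EReal}
    (hconv : ∀ u w : X, ∀ t : ℝ, t ∈ Set.Ioo (0:ℝ) 1 →
      g (t • u + (1 - t) • w) ≤ (t : EReal) * g u + ((1 - t : ℝ) : EReal) * g w)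
    (hbot : ∀ z, g z ≠ ⊥) : Convex ℝ {z | g z ≠ ⊤} := by
  refine convex_iff_forall_pos.2 fun u hu w hw s t hs ht hst => ?_
  have h := hconv u w s ⟨hs, by linarith⟩
  rw [show (1 - s : ℝ) = t by linarith, ← EReal.coe_toReal hu (hbot u),
    ← EReal.coe_toReal hw (hbot w), ← EReal.coe_mul, ← EReal.coe_mul, ← EReal.coe_add] at h
  exact (h.trans_lt (EReal.coe_lt_top _)).ne

theorem ne_top_of_mapClusterPt {X : Type*} [NormedAddCommGroup X] [InnerProductSpace ℝ X]
    [CompleteSpace X] {f : X → ℝ} {g : X → EReal} {f' : X → X} {f'' : X → X →L[ℝ] X}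
    {O : Set X} (hOdom : {z : X | g z ≠ ⊤} ⊆ O) (hbot : ∀ z, g z ≠ ⊥)
    (hlsc : LowerSemicontinuous g) (hconv : Convex ℝ {z | g z ≠ ⊤})
    (hf1 : ∀ z ∈ O, HasGradientAt f (f' z) z) (hf2 : ∀ z ∈ O, HasFDerivAt f' (f'' z) z)
    {x : ℕ → X} {z : X} {c K δ : ℝ} (hz : MapClusterPt z atTop x) (hxD : ∀ k, g (x k) ≠ ⊤)
    (hc : ∀ k, f (x k) + (g (x k)).toReal ≤ c) (hK : 0 ≤ K) (hδ : 0 < δ)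
    (hlip : ∀ a ∈ ball z δ, ∀ b ∈ ball z δ, ‖f'' a - f'' b‖ ≤ K * ‖a - b‖) : g z ≠ ⊤ := by
  obtain ⟨ψ, hψ, hxψ⟩ := hz.tendsto_subseq
  have hball := hxψ.eventually (ball_mem_nhds z hδ)
  obtain ⟨i₀, hi₀⟩ := hball.exists
  set s := {z | g z ≠ ⊤} ∩ ball z δ with hs
  have hsconv : Convex ℝ s := hconv.inter (convex_ball z δ)
  have ha : (x ∘ ψ) i₀ ∈ s := ⟨hxD _, hi₀⟩
  set a := (x ∘ ψ) i₀
  set M := ‖f'' z‖ + K * δ with hM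
  have hM0 : 0 ≤ M := by positivity
  have hdist : ∀ b ∈ s, ‖b - a‖ ≤ 2 * δ := fun b hb => by
    have h1 := mem_ball.1 hb.2
    have h2 := mem_ball'.1 ha.2
    rw [← dist_eq_norm]
    linarith [dist_triangle b z a]
  have hgrad : ∀ b ∈ s, ‖f' b‖ ≤ ‖f' a‖ + M * (2 * δ) := fun b hb => by
    have h1 := hsconv.norm_image_sub_le_of_norm_hasFDerivWithin_le
      (fun w hw => (hf2 w (hOdom hw.1)).hasFDerivWithinAt)
      (fun w hw => norm_le_of_mem_ball_of_lipschitz hK hδ hlip hw.2) ha hb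
    have h2 := norm_sub_norm_le (f' b) (f' a)
    have h3 : M * ‖b - a‖ ≤ M * (2 * δ) := by
      gcongr
      exact hdist b hb
    linarith
  have hval : ∀ b ∈ s, f a - (‖f' a‖ + M * (2 * δ)) * (2 * δ) ≤ f b := fun b hb => by
    have h1 := abs_sub_le_of_norm_gradient_le hsconv (fun w hw => hf1 w (hOdom hw.1)) hgrad ha hb
    have h2 : (‖f' a‖ + M * (2 * δ)) * ‖b - a‖ ≤ (‖f' a‖ + M * (2 * δ)) * (2 * δ) := by
      gcongr
      exact hdist b hb
    have h3 := neg_abs_le (f b - f a)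
    linarith
  have h := hlsc.le_coe_of_tendsto (b := fun _ => c - (f a - (‖f' a‖ + M * (2 * δ)) * (2 * δ)))
    hxψ tendsto_const_nhds (by
      filter_upwards [hball] with i hi
      rw [Function.comp_apply, ← EReal.coe_toReal (hxD (ψ i)) (hbot _)]
      have h1 := hval (x (ψ i)) ⟨hxD (ψ i), hi⟩
      have h2 := hc (ψ i)
      exact EReal.coe_le_coe_iff.2 (by linarith))
  exact (h.trans_lt (EReal.coe_lt_top _)).ne

theorem exists_hessianLipschitzBoundOn_ball {X : Type*} [NormedAddCommGroup X]
    [InnerProductSpace ℝ X] [CompleteSpace X] {f : X → ℝ} {f' : X → X} {f'' : X → X →L[ℝ] X}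
    {O : Set X} (hO : IsOpen O) (hf1 : ∀ z ∈ O, HasGradientAt f (f' z) z)
    (hf2 : ∀ z ∈ O, HasFDerivAt f' (f'' z) z) {z : X} (hz : z ∈ O) {K δ : ℝ} (hK : 0 < K)
    (hδ : 0 < δ)
    (hlip : ∀ a ∈ ball z δ, ∀ b ∈ ball z δ, ‖f'' a - f'' b‖ ≤ K * ‖a - b‖) :
    ∃ δ : ℝ, 0 < δ ∧ ∃ M : ℝ, 0 < M ∧ HessianLipschitzBoundOn f f' f'' (ball z δ) M := by
  have h1 : ∀ᶠ w in 𝓝 z, ‖f' w‖ < ‖f' z‖ + 1 :=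
    (hf2 z hz).continuousAt.norm.eventually (gt_mem_nhds (lt_add_one _))
  have h2 : ∀ᶠ w in 𝓝 z, |f w| < |f z| + 1 :=
    (hf1 z hz).continuousAt.abs.eventually (gt_mem_nhds (lt_add_one _))
  obtain ⟨ε, hε, hball⟩ := Metric.eventually_nhds_iff_ball.1
    (h1.and (h2.and ((hO.eventually_mem hz).and (ball_mem_nhds z hδ))))
  refine ⟨ε, hε, K + (‖f'' z‖ + K * δ) + (‖f' z‖ + 1) + (|f z| + 1), by positivity, ?_⟩
  have hKδ : 0 < K * δ := by positivity
  have e1 := norm_nonneg (f'' z)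
  have e2 := norm_nonneg (f' z)
  have e3 := abs_nonneg (f z)
  exact
    { hasGradientAt := fun w hw => hf1 w (hball w hw).2.2.1
      hasFDerivAt := fun w hw => hf2 w (hball w hw).2.2.1
      lipschitz := fun a ha b hb =>
        (hlip a (hball a ha).2.2.2 b (hball b hb).2.2.2).trans (by gcongr; linarith)
      norm_hessian_le := fun w hw =>
        (norm_le_of_mem_ball_of_lipschitz hK.le hδ hlip (hball w hw).2.2.2).trans (by linarith)
      norm_gradient_le := fun w hw => (hball w hw).1.le.trans (by linarith)
      abs_le := fun w hw => (hball w hw).2.1.le.trans (by linarith) }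

theorem regularization_le_of_descent_fails {X : Type*} [NormedAddCommGroup X]
    [InnerProductSpace ℝ X] [CompleteSpace X] {f : X → ℝ} {f' : X → X} {f'' : X → X →L[ℝ] X}
    {z x y : X} {δ M A q σ l gx gy : ℝ} (hM : 0 < M) (hδ : 0 < δ)
    (hf : HessianLipschitzBoundOn f f' f'' (ball z δ) M) (hx : x ∈ ball z (δ / 2))
    (hq : q ∈ Icc (2 : ℝ) 3) (hσ : σ < 1) (hA : 0 ≤ A) (hg : gx - gy ≤ A * (1 + ‖y - x‖))
    (hyx : y = x → gx = gy)
    (hmodel : ⟪f' x, y - x⟫_ℝ + 1 / 2 * ⟪y - x, f'' x (y - x)⟫_ℝ + l / q * ‖y - x‖ ^ q + gy < gx)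
    (hfail : f x + gx - σ * l / q * ‖y - x‖ ^ q < f y + gy) :
    l ≤ max (q * (3 * (A + M) / min (δ / 2) 1 ^ q)) (q * (M / (1 - σ))) := by
  obtain ⟨hq2, hq3⟩ := hq
  have hq0 : 0 < q := by linarith
  have hxU : x ∈ ball z δ := ball_subset_ball (by linarith) hx
  set ε := min (δ / 2) 1 with hεdef
  have hε : 0 < ε := lt_min (half_pos hδ) one_pos
  have hε1 : ε ≤ 1 := min_le_right _ _
  set d := y - x with hd
  have hd0 : 0 < ‖d‖ := by
    rw [norm_pos_iff]
    intro h0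
    have hgxy := hyx (sub_eq_zero.1 (hd ▸ h0))
    rw [h0, norm_zero, zero_rpow hq0.ne'] at hmodel
    simp [hgxy] at hmodel
  have hdq : 0 < ‖d‖ ^ q := rpow_pos_of_pos hd0 q
  rcases le_or_gt ε ‖d‖ with hle | hlt
  · refine le_max_of_le_left ?_
    have h1 : -(M * ‖d‖) ≤ ⟪f' x, d⟫_ℝ := by
      have h2 := abs_real_inner_le_norm (f' x) d
      have h3 : ‖f' x‖ * ‖d‖ ≤ M * ‖d‖ := by gcongr; exact hf.norm_gradient_le x hxU
      linarith [neg_abs_le ⟪f' x, d⟫_ℝ]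
    have h2 : -(M * ‖d‖ ^ 2) ≤ ⟪d, f'' x d⟫_ℝ := by
      have h3 := abs_real_inner_le_norm d (f'' x d)
      have h4 : ‖d‖ * ‖f'' x d‖ ≤ ‖d‖ * (M * ‖d‖) := by
        gcongr
        exact (f'' x).le_of_opNorm_le (hf.norm_hessian_le x hxU) d
      linarith [neg_abs_le ⟪d, f'' x d⟫_ℝ]
    have h3 : l / q * ‖d‖ ^ q ≤ (A + M) * (1 + ‖d‖ + ‖d‖ ^ 2) := by
      have : 0 ≤ A * ‖d‖ ^ 2 := by positivity
      have : 0 ≤ M * ‖d‖ ^ 2 := by positivity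
      linarith
    have hr : 1 ≤ ‖d‖ / ε := (one_le_div hε).2 hle
    have hdr : ‖d‖ ≤ ‖d‖ / ε := le_div_self hd0.le hε hε1
    have h4 : (‖d‖ / ε) ^ (2 : ℕ) ≤ (‖d‖ / ε) ^ q := by
      rw [← rpow_natCast]
      exact rpow_le_rpow_of_exponent_le hr (by simpa using hq2)
    have h5 : 1 + ‖d‖ + ‖d‖ ^ 2 ≤ 3 * (‖d‖ / ε) ^ q := by
      have h6 : ‖d‖ ^ 2 ≤ (‖d‖ / ε) ^ 2 := by gcongr
      nlinarith
    rw [div_rpow hd0.le hε.le] at h5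
    have h6 : l / q * ‖d‖ ^ q ≤ 3 * (A + M) / ε ^ q * ‖d‖ ^ q :=
      calc _ ≤ (A + M) * (1 + ‖d‖ + ‖d‖ ^ 2) := h3
        _ ≤ (A + M) * (3 * (‖d‖ ^ q / ε ^ q)) := by gcongr
        _ = _ := by ring
    have h7 := le_of_mul_le_mul_right h6 hdq
    rwa [div_le_iff₀' hq0] at h7
  · refine le_max_of_le_right ?_
    have hyU : y ∈ ball z δ := by
      have h1 := mem_ball.1 hx
      have h2 : dist y x < δ / 2 := by
        rw [dist_eq_norm]; exact hlt.trans_le (min_le_left _ _)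
      exact mem_ball.2 (by linarith [dist_triangle y x z])
    have h1 := hf.abs_sub_taylor_le (convex_ball z δ) hM.le hxU hyU
    rw [← hd] at h1
    have h2 := (abs_le.1 h1).2
    have h3 : ‖d‖ ^ 3 ≤ ‖d‖ ^ q := by
      rw [← rpow_natCast]
      exact rpow_le_rpow_of_exponent_ge hd0 (hlt.le.trans hε1) (by simpa using hq3)
    have h4 : M * ‖d‖ ^ 3 ≤ M * ‖d‖ ^ q := by gcongr
    have h5 : (l / q * (1 - σ)) * ‖d‖ ^ q ≤ M * ‖d‖ ^ q := by
      have e : (l / q * (1 - σ)) * ‖d‖ ^ q = l / q * ‖d‖ ^ q - σ * l / q * ‖d‖ ^ q := by ring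
      rw [e]
      linarith
    have h6 := le_of_mul_le_mul_right h5 hdq
    rw [← le_div_iff₀ (by linarith)] at h6
    rwa [div_le_iff₀' hq0] at h6

theorem norm_gradient_add_le_of_inexact_step {X : Type*} [NormedAddCommGroup X]
    [InnerProductSpace ℝ X] [CompleteSpace X] {f : X → ℝ} {f' : X → X} {f'' : X → X →L[ℝ] X}
    {z x y v : X} {δ M q l : ℝ} (hM : 0 ≤ M)
    (hf : HessianLipschitzBoundOn f f' f'' (ball z δ) M) (hq : q ≤ 3) (hl : 0 ≤ l)
    (hx : x ∈ ball z δ) (hy : y ∈ ball z δ) (hp : y - v ∈ ball z δ)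
    (hyx : 0 < ‖y - x‖) (hyx1 : ‖y - x‖ ≤ 1) (hv : ‖v‖ ≤ l * ‖y - x‖ ^ (q - 1)) :
    ‖f' (y - v) + (v - (f' x + f'' x (y - x) + (l * ‖y - x‖ ^ (q - 2)) • (y - x)))‖
      ≤ ((M + 2) * l + M) * ‖y - x‖ ^ (q - 1) := by
  set d := y - x with hd
  have h1 := hf.norm_gradient_sub_le (convex_ball z δ) hy hp
  rw [sub_sub_cancel_left, norm_neg] at h1
  have h2 := hf.norm_gradient_sub_sub_le (convex_ball z δ) hM hx hy
  rw [← hd] at h2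
  have h3 : ‖(l * ‖d‖ ^ (q - 2)) • d‖ = l * ‖d‖ ^ (q - 1) := by
    have h4 : 0 ≤ l * ‖d‖ ^ (q - 2) := mul_nonneg hl (rpow_nonneg hyx.le _)
    rw [norm_smul, norm_eq_abs, abs_of_nonneg h4, mul_assoc, ← rpow_add_one hyx.ne']
    ring_nf
  have h4 : ‖d‖ ^ 2 ≤ ‖d‖ ^ (q - 1) := by
    rw [← rpow_natCast]
    exact rpow_le_rpow_of_exponent_ge hyx hyx1 (by push_cast; linarith)
  have e : f' (y - v) + (v - (f' x + f'' x d + (l * ‖d‖ ^ (q - 2)) • d))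
      = (f' (y - v) - f' y) + (f' y - f' x - f'' x d) + v - (l * ‖d‖ ^ (q - 2)) • d := by abel
  rw [e]
  have h5 := norm_sub_le ((f' (y - v) - f' y) + (f' y - f' x - f'' x d) + v)
    ((l * ‖d‖ ^ (q - 2)) • d)
  have h6 := norm_add₃_le (a := f' (y - v) - f' y) (b := f' y - f' x - f'' x d) (c := v)
  have h7 : M * ‖d‖ ^ 2 ≤ M * ‖d‖ ^ (q - 1) := by gcongr
  have h8 : M * ‖v‖ ≤ M * (l * ‖d‖ ^ (q - 1)) := by gcongr
  linarith

/-- Theorem 4.2(ii): under Assumption 2 and the KL property of F with exponent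
θ ∈ [(q-1)/q, 1), the iterates converge R-linearly (θ = (q-1)/q) or sublinearly
(θ ∈ ((q-1)/q, 1)). -/
theorem convergence_rate_large_KL_exponent
    {X : Type*} [NormedAddCommGroup X] [InnerProductSpace ℝ X] [FiniteDimensional ℝ X]
    -- the data of problem (1): f twice continuously differentiable on an open set O ⊇ dom g,
    -- g proper lsc convex, F = f + g bounded below
    (f : X → ℝ) (g : X → EReal) (f' : X → X) (f'' : X → X →L[ℝ] X)
    (O : Set X) (hO : IsOpen O) (hOdom : {z : X | g z ≠ ⊤} ⊆ O)
    (hgproper : ∃ z : X, g z ≠ ⊤) (hgnebot : ∀ z : X, g z ≠ ⊥)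
    (hglsc : LowerSemicontinuous g)
    (hgconv : ∀ u w : X, ∀ t : ℝ, t ∈ Set.Ioo (0:ℝ) 1 →
        g (t • u + (1 - t) • w) ≤ (t : EReal) * g u + ((1 - t : ℝ) : EReal) * g w)
    (hf1 : ∀ z ∈ O, HasGradientAt f (f' z) z)
    (hf2 : ∀ z ∈ O, HasFDerivAt f' (f'' z) z)
    (hf2c : ContinuousOn f'' O)
    -- the proximal mapping of g
    (proxg : X → X)
    (hproxg : ∀ w z : X,
        ((1/2 * ‖proxg w - w‖ ^ 2 : ℝ) : EReal) + g (proxg w) ≤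
          ((1/2 * ‖z - w‖ ^ 2 : ℝ) : EReal) + g z)
    (F : X → EReal) (hF : ∀ z : X, F z = (f z : EReal) + g z)
    (hFbdd : ∃ m : ℝ, ∀ z : X, (m : EReal) ≤ F z)
    -- Algorithm 1 parameters
    (q Lmin Lmax ϱ σ τ : ℝ)
    (hq : q ∈ Set.Icc (2:ℝ) 3) (hLmin : 0 < Lmin) (hLmm : Lmin < Lmax)
    (hϱ : ϱ ∈ Set.Ioo (0:ℝ) 1) (hσ : σ ∈ Set.Ioo (0:ℝ) 1) (hτ : 1 < τ)
    -- the sequences generated by Algorithm 1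
    (x y v : ℕ → X) (L L0 : ℕ → ℝ) (j : ℕ → ℕ)
    (hx0 : g (x 0) ≠ ⊤)
    (hL0 : ∀ k : ℕ, L0 k ∈ Set.Icc Lmin Lmax)
    (hLdef : ∀ k : ℕ, L k = τ ^ j k * L0 k)
    -- the quadratic model ϑ_k, the regularized model objective Θ_{k,L} and its KKT residual map
    (ϑ : ℕ → X → ℝ)
    (hϑ : ∀ k : ℕ, ∀ z : X, ϑ k z = f (x k) + ⟪f' (x k), z - x k⟫_ℝ
        + 1/2 * ⟪z - x k, f'' (x k) (z - x k)⟫_ℝ)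
    (Θ : ℕ → ℝ → X → EReal)
    (hΘ : ∀ k : ℕ, ∀ l : ℝ, ∀ z : X,
        Θ k l z = ((ϑ k z + l / q * ‖z - x k‖ ^ q : ℝ) : EReal) + g z)
    (Rk : ℕ → ℝ → X → X)
    (hRk : ∀ k : ℕ, ∀ l : ℝ, ∀ z : X, Rk k l z = z - proxg (z -
        (f' (x k) + f'' (x k) (z - x k) + (l * ‖z - x k‖ ^ (q - 2)) • (z - x k))))
    -- inexactness criterion and descent condition at each iteration
    (hydom : ∀ k : ℕ, g (y k) ≠ ⊤)
    (hinex1 : ∀ k : ℕ, ‖Rk k (L k) (y k)‖ ≤ ϱ * L k * ‖y k - x k‖ ^ (q - 1))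
    (hinex2 : ∀ k : ℕ, Θ k (L k) (y k) < Θ k (L k) (x k))
    (hdesc : ∀ k : ℕ, F (y k) ≤ F (x k) - ((σ * L k / q * ‖y k - x k‖ ^ q : ℝ) : EReal))
    (hv : ∀ k : ℕ, v k = Rk k (L k) (y k))
    (hxsucc : ∀ k : ℕ, x (k + 1) = if F (y k) < F (y k - v k) then y k else y k - v k)
    -- if j_k ≥ 1, the previous trial point failed the descent test
    (hback : ∀ k : ℕ, 1 ≤ j k → ∃ yt : X, g yt ≠ ⊤ ∧
        ‖Rk k (L k / τ) yt‖ ≤ ϱ * (L k / τ) * ‖yt - x k‖ ^ (q - 1) ∧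
        Θ k (L k / τ) yt < Θ k (L k / τ) (x k) ∧
        F (x k) - ((σ * (L k / τ) / q * ‖yt - x k‖ ^ q : ℝ) : EReal) < F yt)
    -- Assumption 2: bounded level set; ∇²f locally Lipschitz on an open convex set N ⊇ ω(x⁰)
    (hlevel : Bornology.IsBounded {z : X | F z ≤ F (x 0)})
    (N : Set X) (hNopen : IsOpen N) (hNconv : Convex ℝ N)
    (hNomega : {z : X | MapClusterPt z atTop x} ⊆ N)
    (hHloc : ∀ z ∈ N, ∃ K : ℝ, 0 < K ∧ ∃ δ : ℝ, 0 < δ ∧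
        ∀ a ∈ Metric.ball z δ ∩ N, ∀ b ∈ Metric.ball z δ ∩ N,
          ‖f'' a - f'' b‖ ≤ K * ‖a - b‖)
    -- F is a KL function of exponent θ ∈ [(q-1)/q, 1)
    (θ : ℝ) (hθ : θ ∈ Set.Ico ((q - 1) / q) 1)
    (hKL : ∀ xc : X, (ESubdiff g xc).Nonempty →
        ∃ δ : ℝ, 0 < δ ∧ ∃ ϖ : EReal, 0 < ϖ ∧ ∃ c : ℝ, 0 < c ∧
          ∀ z ∈ Metric.ball xc δ, F xc < F z → F z < F xc + ϖ →
            ∀ w ∈ ESubdiff g z,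
              1 ≤ c * (1 - θ) * (F z - F xc).toReal ^ (-θ) * ‖f' z + w‖) :
    ∃ xb : X, -f' xb ∈ ESubdiff g xb ∧ Tendsto x atTop (𝓝 xb) ∧
      ∃ α : ℝ, 0 < α ∧ ∃ ρ ∈ Set.Ioo (0:ℝ) 1, ∃ K : ℕ, ∀ k : ℕ, K ≤ k →
        (θ = (q - 1) / q → ‖x k - xb‖ ≤ α * ρ ^ k) ∧
        ((q - 1) / q < θ →
          ‖x k - xb‖ ≤ α * (k : ℝ) ^ ((1 - θ) / (1 - q * θ / (q - 1)))) := by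
  have : ProperSpace X := FiniteDimensional.proper ℝ X
  obtain ⟨hq2, hq3⟩ := hq
  have hq0 : 0 < q := by linarith
  have hτ0 : 0 < τ := by linarith
  set G : X → ℝ := fun z => (g z).toReal with hGdef
  have hG : ∀ z, g z ≠ ⊤ → g z = (G z : EReal) := fun z hz =>
    (EReal.coe_toReal hz (hgnebot z)).symm
  have hFr : ∀ z, g z ≠ ⊤ → F z = ((f z + G z : ℝ) : EReal) := fun z hz => by
    rw [hF, hG z hz, EReal.coe_add]
  -- the proximal points and their subgradients
  set h : ℕ → X := fun k => f' (x k) + f'' (x k) (y k - x k)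
    + (L k * ‖y k - x k‖ ^ (q - 2)) • (y k - x k) with hhdef
  set p : ℕ → X := fun k => y k - v k with hpdef
  have hp : ∀ k, p k = proxg (y k - h k) := fun k => by
    simp only [hpdef, hv, hRk, sub_sub_cancel, hhdef]
  have hpD : ∀ k, g (p k) ≠ ⊤ := fun k => by
    rw [hp k]
    exact ne_top_of_isProx hgproper (hproxg _)
  have hu : ∀ k, v k - h k ∈ ESubdiff g (p k) := fun k => by
    have h1 := sub_mem_ESubdiff_of_isProx hgproper hgnebot hgconv (hproxg (y k - h k))
    rw [← hp k] at h1
    convert h1 using 1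
    simp only [hpdef]
    abel
  have hxD : ∀ k, g (x k) ≠ ⊤ := fun k => by
    cases k with
    | zero => exact hx0
    | succ k =>
      rw [hxsucc k]
      split_ifs
      exacts [hydom k, hpD k]
  -- positivity of the regularization parameters and of the steps
  have hLpos : ∀ k, Lmin ≤ L k := fun k => by
    rw [hLdef k]
    have h1 := (hL0 k).1
    have h2 : 1 ≤ τ ^ j k := one_le_pow₀ hτ.le
    nlinarith
  have hΘx : ∀ k l, Θ k l (x k) = ((f (x k) + G (x k) : ℝ) : EReal) := fun k l => by
    rw [hΘ, hϑ, hG _ (hxD k), ← EReal.coe_add]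
    simp [zero_rpow hq0.ne']
  have hmodel : ∀ k l z, g z ≠ ⊤ → Θ k l z < Θ k l (x k) →
      ⟪f' (x k), z - x k⟫_ℝ + 1 / 2 * ⟪z - x k, f'' (x k) (z - x k)⟫_ℝ
        + l / q * ‖z - x k‖ ^ q + G z < G (x k) := fun k l z hz hlt => by
    rw [hΘx, hΘ, hϑ, hG z hz, ← EReal.coe_add, EReal.coe_lt_coe_iff] at hlt
    linarith
  set s : ℕ → ℝ := fun k => ‖y k - x k‖ with hsdef
  have hs : ∀ k, 0 < s k := fun k => by
    refine norm_pos_iff.2 (sub_ne_zero.2 fun hyx => ?_)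
    have h1 := hinex2 k
    rw [hyx] at h1
    exact lt_irrefl _ h1
  -- descent
  have hnext : ∀ k, f (x (k + 1)) + G (x (k + 1)) ≤ f (y k) + G (y k) ∧
      f (x (k + 1)) + G (x (k + 1)) ≤ f (p k) + G (p k) := fun k => by
    have e1 := hFr _ (hydom k)
    have e2 := hFr _ (hpD k)
    rw [hxsucc k]
    split_ifs with hlt
    · rw [e1, show F (y k - v k) = _ from e2, EReal.coe_lt_coe_iff] at hlt
      exact ⟨le_rfl, hlt.le⟩
    · rw [not_lt, e1, show F (y k - v k) = _ from e2, EReal.coe_le_coe_iff] at hlt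
      exact ⟨hlt, le_rfl⟩
  have ha : 0 < σ * Lmin / q := div_pos (mul_pos hσ.1 hLmin) hq0
  have hdec : ∀ k, σ * Lmin / q * s k ^ q ≤
      (f (x k) + G (x k)) - (f (x (k + 1)) + G (x (k + 1))) := fun k => by
    have h1 := hdesc k
    rw [hFr _ (hydom k), hFr _ (hxD k), ← EReal.coe_sub, EReal.coe_le_coe_iff] at h1
    have h2 : σ * Lmin / q * s k ^ q ≤ σ * L k / q * ‖y k - x k‖ ^ q := by
      have := hσ.1
      gcongr
      exact hLpos k
    linarith [(hnext k).1]
  obtain ⟨m, hm⟩ := hFbdd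
  have hm' : ∀ k, m ≤ f (x k) + G (x k) := fun k => by
    have h1 := hm (x k)
    rwa [hFr _ (hxD k), EReal.coe_le_coe_iff] at h1
  obtain ⟨l, hl, hlt, hs0⟩ := exists_tendsto_lt_of_sufficient_decrease hq0 ha hs hm' hdec
  have hanti : Antitone fun k => f (x k) + G (x k) := antitone_nat_of_succ_le fun k => by
    have h1 := mul_pos ha (rpow_pos_of_pos (hs k) q)
    linarith [hdec k]
  have hF0 : ∀ k, f (x k) + G (x k) ≤ f (x 0) + G (x 0) := fun k => hanti (Nat.zero_le k)
  -- compactness of the trajectory and local bounds on `f` around its cluster points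
  set S : Set X := closure {z : X | F z ≤ F (x 0)} with hSdef
  have hS : IsCompact S := hlevel.isCompact_closure
  have hxS : ∀ k, x k ∈ S := fun k => subset_closure (by
    rw [mem_ofPred_eq, hFr _ (hxD k), hFr _ hx0, EReal.coe_le_coe_iff]
    exact hF0 k)
  have hcD : ∀ z, MapClusterPt z atTop x → g z ≠ ⊤ := fun z hz => by
    obtain ⟨K, hK, δ, hδ, hlip⟩ := exists_ball_lipschitz hNopen hHloc (hNomega hz)
    exact ne_top_of_mapClusterPt hOdom hgnebot hglsc (convex_setOf_ne_top hgconv hgnebot) hf1 hf2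
      hz hxD hF0 hK.le hδ hlip
  obtain ⟨δ, hδ, M, hM, hf⟩ : ∃ δ : ℝ, 0 < δ ∧ ∃ M : ℝ, 0 < M ∧
      ∀ z ∈ {z | MapClusterPt z atTop x}, HessianLipschitzBoundOn f f' f'' (ball z δ) M := by
    refine exists_uniform_ball_of_isCompact (Q := HessianLipschitzBoundOn f f' f'')
      (isCompact_setOf_mapClusterPt hS hxS) (fun _ _ _ _ _ hst hMM h => h.mono hst hMM)
      fun z hz => ?_
    obtain ⟨K, hK, δ, hδ, hlip⟩ := exists_ball_lipschitz hNopen hHloc (hNomega hz)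
    exact exists_hessianLipschitzBoundOn_ball hO hf1 hf2 (hOdom (hcD z hz)) hK hδ hlip
  -- eventual boundedness of the regularization parameters
  obtain ⟨Lb, hLb0, hLb⟩ : ∃ Lb : ℝ, 0 < Lb ∧ ∀ᶠ k in atTop, L k ≤ Lb := by
    obtain ⟨R, hR⟩ := hS.isBounded.exists_norm_le
    have hp0 := ne_top_of_isProx hgproper (hproxg 0)
    have hu0 := sub_mem_ESubdiff_of_isProx hgproper hgnebot hgconv (hproxg 0)
    set p₀ := proxg 0
    set u₀ := 0 - p₀
    have hR0 : 0 ≤ R := (norm_nonneg _).trans (hR _ (hxS 0))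
    set A := |f (x 0) + G (x 0)| + M + |G p₀| + ‖u₀‖ * (R + ‖p₀‖) + ‖u₀‖ with hA
    have hA0 : 0 ≤ A := by positivity
    set Λ := max (q * (3 * (A + M) / min (δ / 2) 1 ^ q)) (q * (M / (1 - σ)))
    refine ⟨max Lmax (τ * Λ), lt_max_of_lt_left (hLmin.trans hLmm), ?_⟩
    filter_upwards [eventually_exists_dist_mapClusterPt_lt hS hxS (half_pos hδ)] with k hk
    obtain ⟨z, hz, hxz⟩ := hk
    rcases Nat.eq_zero_or_pos (j k) with hj | hj
    · refine le_max_of_le_left ?_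
      rw [hLdef k, hj, pow_zero, one_mul]
      exact (hL0 k).2
    · refine le_max_of_le_right ?_
      obtain ⟨yt, hyt, -, hyt2, hyt3⟩ := hback k hj
      rw [hFr _ hyt, hFr _ (hxD k), ← EReal.coe_sub, EReal.coe_lt_coe_iff] at hyt3
      have hxU : x k ∈ ball z δ := mem_ball.2 (by linarith)
      have h1 := (neg_abs_le _).trans' (neg_le_neg ((hf z hz).abs_le _ hxU))
      have h2 : G p₀ + ⟪u₀, yt - p₀⟫_ℝ ≤ G yt :=
        toReal_add_inner_le_of_mem_ESubdiff hgnebot hu0 hyt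
      have h3 : -(‖u₀‖ * (‖yt - x k‖ + (R + ‖p₀‖))) ≤ ⟪u₀, yt - p₀⟫_ℝ := by
        refine (neg_le_neg ?_).trans (neg_le_of_abs_le (abs_real_inner_le_norm u₀ (yt - p₀)))
        gcongr
        have e : yt - p₀ = (yt - x k) + (x k - p₀) := by abel
        rw [e]
        exact (norm_add_le _ _).trans (add_le_add_right ((norm_sub_le _ _).trans
          (add_le_add_left (hR _ (hxS k)) _)) _)
      have h4 : G (x k) - G yt ≤ A * (1 + ‖yt - x k‖) := by
        have e1 := le_abs_self (f (x 0) + G (x 0))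
        have e2 := neg_abs_le (G p₀)
        have e3 : ‖u₀‖ * ‖yt - x k‖ ≤ A * ‖yt - x k‖ := by
          gcongr
          rw [hA]
          have : 0 ≤ |f (x 0) + G (x 0)| + M + |G p₀| + ‖u₀‖ * (R + ‖p₀‖) := by positivity
          linarith
        have e4 := norm_nonneg u₀
        have e5 := hF0 k
        rw [hA] at e3 ⊢
        linarith
      have h5 : L k / τ ≤ Λ := regularization_le_of_descent_fails hM hδ (hf z hz)
        (mem_ball.2 hxz) ⟨hq2, hq3⟩ hσ.2 hA0 h4 (fun e => by rw [e]) (hmodel k _ yt hyt hyt2) hyt3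
      rwa [div_le_iff₀' hτ0] at h5
  -- step-size and gradient estimates
  have hvs : ∀ k, ‖v k‖ ≤ L k * s k ^ (q - 1) := fun k => by
    rw [hv k]
    refine (hinex1 k).trans ?_
    have h1 := hLpos k
    have h2 : ϱ * L k ≤ L k := mul_le_of_le_one_left (by linarith) hϱ.2.le
    exact mul_le_mul_of_nonneg_right h2 (rpow_nonneg (hs k).le _)
  have hs1 : ∀ᶠ k in atTop, s k ≤ 1 :=
    (hs0.eventually (gt_mem_nhds one_pos)).mono fun k hk => le_of_lt hk
  have hvs' : ∀ᶠ k in atTop, ‖v k‖ ≤ Lb * s k := by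
    filter_upwards [hs1, hLb] with k hk1 hkL
    refine (hvs k).trans ?_
    have h1 : s k ^ (q - 1) ≤ s k := by
      simpa using rpow_le_rpow_of_exponent_ge (hs k) hk1 (by linarith : 1 ≤ q - 1)
    exact mul_le_mul hkL h1 (rpow_nonneg (hs k).le _) hLb0.le
  have hpx : ∀ᶠ k in atTop, ‖p k - x k‖ ≤ (1 + Lb) * s k := hvs'.mono fun k hk => by
    have e : p k - x k = (y k - x k) - v k := by
      simp only [hpdef]
      abel
    rw [e, one_add_mul]
    exact (norm_sub_le _ _).trans (add_le_add_right hk _)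
  have hxx : ∀ᶠ k in atTop, dist (x k) (x (k + 1)) ≤ (1 + Lb) * s k := hpx.mono fun k hk => by
    rw [dist_comm, dist_eq_norm, hxsucc k]
    split_ifs
    · rw [one_add_mul]
      have := mul_pos hLb0 (hs k)
      exact le_add_of_nonneg_right this.le
    · exact hk
  have hB : 0 < 1 + Lb := by linarith
  have hBs : ∀ᶠ k in atTop, (1 + Lb) * s k < δ / 2 := by
    have h1 := hs0.const_mul (1 + Lb)
    rw [mul_zero] at h1
    exact h1.eventually (gt_mem_nhds (half_pos hδ))
  have hgrad : ∀ᶠ k in atTop,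
      ‖f' (p k) + (v k - h k)‖ ≤ ((M + 2) * Lb + M) * s k ^ (q - 1) := by
    filter_upwards [hs1, hLb, hpx, hBs,
      eventually_exists_dist_mapClusterPt_lt hS hxS (half_pos hδ)] with k hk1 hkL hkp hkB hk
    obtain ⟨z, hz, hxz⟩ := hk
    have hsB : s k ≤ (1 + Lb) * s k := by
      rw [one_add_mul]
      exact le_add_of_nonneg_right (mul_pos hLb0 (hs k)).le
    have hnear : ∀ w, ‖w - x k‖ ≤ (1 + Lb) * s k → w ∈ ball z δ := fun w hw => by
      have h1 := dist_triangle w (x k) z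
      rw [dist_eq_norm w (x k)] at h1
      exact mem_ball.2 (by linarith)
    have hL0 : 0 ≤ L k := hLmin.le.trans (hLpos k)
    refine (norm_gradient_add_le_of_inexact_step hM.le (hf z hz) hq3 hL0
      (mem_ball.2 (by linarith)) (hnear _ hsB) (hnear _ hkp) (hs k) hk1 (hvs k)).trans ?_
    have h1 := rpow_nonneg (hs k).le (q - 1)
    change _ * s k ^ (q - 1) ≤ _
    gcongr
  have hC : 0 < (M + 2) * Lb + M := by positivity
  obtain ⟨xb, hxb1, hxb2, hrate⟩ := convergence_rate_of_inexact_prox_descent hgnebot hglsc hF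
    (by linarith) hθ ha hB hC hKL hS hxS hxD hpD hu hcD hδ hf hs hs0 hl hlt hdec
    (fun k => (hnext k).2) hpx hxx hgrad
  simp only [dist_eq_norm] at hrate
  exact ⟨xb, hxb1, hxb2, hrate⟩
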